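/- arXiv:0812.5063 — 2 statements merged into one kernel-verified Lean document; each statement's English description precedes it below -/
import Mathlib

section
/- Let x be a nilpotent element of gl_{2n}(F) (F of characteristic zero) satisfying εxε = -x where ε = diag(I_n, -I_n), and let (x, d, x_-) be an sl2-triple with d ∈ gl_n(F) × gl_n(F) (the even part with respect to conjugation by ε). Then Tr(ad(d) restricted to the centralizer of x in gl_n(F) × gl_n(F)) < 2n². -/
set_option linter.unusedSectionVars false

section Sl2
variable {F M : Type*} [Field F] [CharZero F] [AddCommGroup M] [Module F M]

/-- product of `h - a` over a list of integers -/
def PL (h : Module.End F M) (L : List ℤ) : Module.End F M :=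
  (L.map (fun a : ℤ => h - (a : F) • (1 : Module.End F M))).prod

lemma PL_nil (h : Module.End F M) (v : M) : PL h [] v = v := rfl

lemma PL_cons (h : Module.End F M) (a : ℤ) (L : List ℤ) (v : M) :
    PL h (a :: L) v = h (PL h L v) - (a : F) • PL h L v := by
  simp [PL]

lemma PL_append (h : Module.End F M) (L L' : List ℤ) (v : M) :
    PL h (L ++ L') v = PL h L (PL h L' v) := by
  simp [PL]

lemma PL_h (h : Module.End F M) (L : List ℤ) (v : M) :
    PL h L (h v) = h (PL h L v) := by
  induction L with
  | nil => rfl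
  | cons a L ih => simp [PL_cons, ih]

lemma PL_comm (h : Module.End F M) (L L' : List ℤ) (v : M) :
    PL h L (PL h L' v) = PL h L' (PL h L v) := by
  induction L' with
  | nil => rfl
  | cons a L' ih => simp [PL_cons, PL_h, ih]

lemma PL_shift (h e : Module.End F M) (s : ℤ) (he : ∀ v, h (e v) = e (h v) + (s : F) • e v)
    (L : List ℤ) (v : M) : PL h (L.map (fun a => a + s)) (e v) = e (PL h L v) := by
  induction L with
  | nil => rfl
  | cons a L ih =>
    rw [List.map_cons, PL_cons, PL_cons, ih, he, map_sub, map_smul]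
    push_cast
    module

lemma pow_shift (h e : Module.End F M) (s : ℤ) (he : ∀ v, h (e v) = e (h v) + (s : F) • e v)
    (m : ℕ) (v : M) : h ((e ^ m) v) = (e ^ m) (h v) + ((m * s : ℤ) : F) • (e ^ m) v := by
  induction m with
  | zero => simp
  | succ m ih =>
    rw [pow_succ', Module.End.mul_apply, Module.End.mul_apply, he, ih, map_add, map_smul]
    push_cast
    module

lemma PL_eig (h : Module.End F M) (L : List ℤ) (w : ℤ) (v : M) (hv : h v = (w : F) • v) :
    PL h L v = (((L.map (fun a => w - a)).prod : ℤ) : F) • v := by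
  induction L with
  | nil => simp [PL_nil]
  | cons a L ih =>
    rw [PL_cons, ih, map_smul, hv, List.map_cons, List.prod_cons]
    push_cast
    module

lemma PL_eig_zero (h : Module.End F M) (L : List ℤ) (w : ℤ) (v : M) (hv : h v = (w : F) • v)
    (hL : w ∉ L) (h0 : PL h L v = 0) : v = 0 := by
  rw [PL_eig h L w v hv, smul_eq_zero] at h0
  rcases h0 with h0 | h0
  · exfalso
    rw [Int.cast_eq_zero, List.prod_eq_zero_iff, List.mem_map] at h0
    obtain ⟨a, ha, h1⟩ := h0
    exact hL (by rwa [show w = a by omega])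
  · exact h0

lemma PL_disjoint (h : Module.End F M) (L L' : List ℤ) (hL : ∀ a ∈ L, a ∉ L') (v : M)
    (h1 : PL h L v = 0) (h2 : PL h L' v = 0) : v = 0 := by
  induction L with
  | nil => exact h1
  | cons a L ih =>
    apply ih (fun b hb => hL b (List.mem_cons_of_mem _ hb))
    rw [PL_cons, sub_eq_zero] at h1
    apply PL_eig_zero h L' a _ h1 (hL a List.mem_cons_self)
    rw [PL_comm, h2, map_zero]

lemma PL_nodup (h : Module.End F M) (L : List ℤ) (hL : L.Nodup) (w : ℤ) (v z : M)
    (hv : h v = (w : F) • v + z) (hz : h z = (w : F) • z) (h0 : PL h L v = 0) : z = 0 := by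
  have hzv : z = h v - (w : F) • v := by rw [hv]; simp
  by_cases hw : w ∈ L
  · obtain ⟨L1, L2, rfl⟩ := List.append_of_mem hw
    apply PL_eig_zero h (L1 ++ L2) w z hz
    · have := List.nodup_middle.1 hL
      simpa using (List.nodup_cons.1 this).1
    · rw [PL_append, PL_cons] at h0
      rw [PL_append, hzv, map_sub, PL_h, map_smul]
      exact h0
  · apply PL_eig_zero h L w z hz hw
    rw [hzv, map_sub, PL_h, map_smul, h0]
    simp

/-- spanning by eigenvectors -/
lemma span_eig (h : Module.End F M) (L : List ℤ) (h0 : ∀ v, PL h L v = 0)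
    (hs : ∀ (w : ℤ) (v z : M), h v = (w : F) • v + z → h z = (w : F) • z → z = 0) :
    Submodule.span F {v : M | ∃ w : ℤ, h v = (w : F) • v} = ⊤ := by
  rw [Submodule.eq_top_iff']
  intro v
  have key : ∀ (L : List ℤ) (v : M), PL h L v = 0 →
      v ∈ Submodule.span F {v : M | ∃ w : ℤ, h v = (w : F) • v} := by
    intro L
    induction L with
    | nil => intro v hv; rw [PL_nil] at hv; rw [hv]; exact Submodule.zero_mem _
    | cons a L ih =>
      intro v hv
      have hy : h v - (a : F) • v ∈ Submodule.span F {v : M | ∃ w : ℤ, h v = (w : F) • v} := by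
        apply ih
        rw [map_sub, PL_h, map_smul, ← PL_cons, hv]
      have : ∀ y ∈ Submodule.span F {v : M | ∃ w : ℤ, h v = (w : F) • v},
          ∃ v0 ∈ Submodule.span F {v : M | ∃ w : ℤ, h v = (w : F) • v}, ∃ ya,
            h ya = (a : F) • ya ∧ y = h v0 - (a : F) • v0 + ya := by
        intro y hy
        induction hy using Submodule.span_induction with
        | mem y hy =>
          obtain ⟨w, hw⟩ := hy
          by_cases hwa : w = a
          · exact ⟨0, Submodule.zero_mem _, y, by rw [hw, hwa], by simp⟩
          · have hne : (w : F) - a ≠ 0 := by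
              rw [sub_ne_zero]; exact_mod_cast hwa
            refine ⟨((w : F) - a)⁻¹ • y, Submodule.smul_mem _ _ (Submodule.subset_span ⟨w, hw⟩),
              0, by simp, ?_⟩
            rw [map_smul, hw, smul_comm, ← sub_smul, smul_smul, mul_inv_cancel₀ hne]
            simp
        | zero => exact ⟨0, Submodule.zero_mem _, 0, by simp, by simp⟩
        | add y y' _ _ h1 h2 =>
          obtain ⟨v1, m1, y1, e1, rfl⟩ := h1
          obtain ⟨v2, m2, y2, e2, rfl⟩ := h2
          exact ⟨v1 + v2, Submodule.add_mem _ m1 m2, y1 + y2, by rw [map_add, e1, e2, smul_add],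
            by rw [map_add]; module⟩
        | smul c y _ h1 =>
          obtain ⟨v1, m1, y1, e1, rfl⟩ := h1
          exact ⟨c • v1, Submodule.smul_mem _ _ m1, c • y1, by rw [map_smul, e1, smul_comm],
            by rw [map_smul]; module⟩
      obtain ⟨v0, m0, ya, e1, e2⟩ := this _ hy
      have hya : ya = 0 := by
        apply hs a (v - v0) ya _ e1
        rw [map_sub]
        rw [sub_eq_iff_eq_add] at e2
        rw [e2]; module
      have : v - v0 ∈ Submodule.span F {v : M | ∃ w : ℤ, h v = (w : F) • v} := by
        apply Submodule.subset_span
        refine ⟨a, ?_⟩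
        rw [hya, sub_eq_iff_eq_add] at e2
        rw [map_sub, e2]; module
      simpa using Submodule.add_mem _ this m0
  exact key L v (h0 v)

lemma fe_step (e h f : Module.End F M) (he : ∀ v, h (e v) = e (h v) + (2 : F) • e v)
    (hf : ∀ v, e (f v) = f (e v) + h v) (k : ℕ) (v : M) :
    f (e ((e ^ k) v)) = (e ^ k) (f (e v) - (k : F) • h v - ((k : F) * (k + 1)) • v) := by
  induction k generalizing v with
  | zero => simp
  | succ k ih =>
    rw [pow_succ, Module.End.mul_apply, ih, Module.End.mul_apply]
    congr 1
    simp only [map_sub, map_smul, hf, he]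
    push_cast
    module

lemma fe_pow (e h f : Module.End F M) (he : ∀ v, h (e v) = e (h v) + (2 : F) • e v)
    (hf : ∀ v, e (f v) = f (e v) + h v) (k : ℕ) (v : M) :
    (f ^ (k + 1)) ((e ^ (k + 1)) v) =
      (f ^ k) ((e ^ k) (f (e v) - (k : F) • h v - ((k : F) * (k + 1)) • v)) := by
  rw [← fe_step e h f he hf, pow_succ f, pow_succ' e]
  rfl

def Lneg (k : ℕ) : List ℤ := (List.range k).map (fun j : ℕ => -(j : ℤ))

lemma image_step (e h f : Module.End F M) (he : ∀ v, h (e v) = e (h v) + (2 : F) • e v)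
    (hf : ∀ v, e (f v) = f (e v) + h v) (k : ℕ) :
    ∃ c : F, c ≠ 0 ∧ ∀ v, (f ^ k) ((e ^ k) v) - c • PL h (Lneg k) v ∈ LinearMap.range e := by
  have hR : ∀ L u, PL h L (e u) ∈ LinearMap.range e := by
    intro L u
    have := PL_shift h e 2 (by exact_mod_cast he) (L.map (fun a => a - 2)) u
    simp only [List.map_map] at this
    have h2 : ((fun a : ℤ => a + 2) ∘ fun a => a - 2) = id := by funext a; simp
    rw [h2, List.map_id] at this
    rw [this]
    exact ⟨_, rfl⟩
  induction k with
  | zero => exact ⟨1, one_ne_zero, fun v => by simp [Lneg, PL_nil]⟩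
  | succ k ih =>
    obtain ⟨c, hc, ih⟩ := ih
    refine ⟨-c * (k + 1), mul_ne_zero (neg_ne_zero.2 hc) (by exact_mod_cast Nat.succ_ne_zero k), ?_⟩
    intro v
    rw [fe_pow e h f he hf]
    have h1 : f (e v) - (k : F) • h v - ((k : F) * (k + 1)) • v
      = e (f v) - ((k : F) + 1) • (h v + (k : F) • v) := by rw [hf]; module
    have h2 : PL h (Lneg (k + 1)) v = PL h (Lneg k) (h v + (k : F) • v) := by
      rw [Lneg, List.range_succ, List.map_append, PL_append]
      simp [PL_cons, PL_nil, Lneg]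
    rw [h1, h2]
    set u := h v + (k : F) • v
    have a1 := ih (e (f v))
    have a2 := Submodule.smul_mem _ c (hR (Lneg k) (f v))
    have a3 := Submodule.smul_mem _ ((k : F) + 1) (ih u)
    have := Submodule.sub_mem _ (Submodule.add_mem _ a1 a2) a3
    convert this using 1
    simp only [map_sub, map_smul]
    module

lemma image_pl (e h f : Module.End F M) (he : ∀ v, h (e v) = e (h v) + (2 : F) • e v)
    (hf : ∀ v, e (f v) = f (e v) + h v) (N : ℕ) (hN : e ^ N = 0) (v : M) :
    PL h (Lneg N) v ∈ LinearMap.range e := by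
  obtain ⟨c, hc, H⟩ := image_step e h f he hf N
  have := Submodule.smul_mem _ (-c⁻¹) (H v)
  rw [hN] at this
  simpa [smul_smul, hc] using this

lemma exists_PL (e h f : Module.End F M) (he : ∀ v, h (e v) = e (h v) + (2 : F) • e v)
    (hf : ∀ v, e (f v) = f (e v) + h v) (N : ℕ) (hN : e ^ N = 0) :
    ∃ L : List ℤ, ∀ v, PL h L v = 0 := by
  have : ∀ m : ℕ, ∃ L : List ℤ, ∀ v, PL h L v ∈ LinearMap.range (e ^ m) := by
    intro m
    induction m with
    | zero => exact ⟨[], fun v => ⟨v, rfl⟩⟩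
    | succ m ih =>
      obtain ⟨L, hL⟩ := ih
      refine ⟨(Lneg N).map (fun a => a + (m * 2 : ℤ)) ++ L, fun v => ?_⟩
      obtain ⟨w, hw⟩ := hL v
      obtain ⟨y, hy⟩ := image_pl e h f he hf N hN w
      rw [PL_append, ← hw, PL_shift h (e ^ m) (m * 2)
        (pow_shift h e 2 (by exact_mod_cast he) m), ← hy]
      exact ⟨y, by rw [pow_succ]; rfl⟩
  obtain ⟨L, hL⟩ := this N
  refine ⟨L, fun v => ?_⟩
  obtain ⟨w, hw⟩ := hL v
  rw [← hw, hN]; rfl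

lemma f_nilp (h f : Module.End F M) (hf' : ∀ v, h (f v) = f (h v) + ((-2 : ℤ) : F) • f v)
    (L : List ℤ) (hL : ∀ v, PL h L v = 0) : ∃ N, f ^ N = 0 := by
  have hb : ∃ B : ℕ, ∀ a ∈ L, a.natAbs < B := by
    clear hL
    induction L with
    | nil => exact ⟨0, by simp⟩
    | cons a L ih =>
      obtain ⟨B, hB⟩ := ih
      refine ⟨max B (a.natAbs + 1), ?_⟩
      intro b hb
      rcases List.mem_cons.1 hb with rfl | hb
      · omega
      · have := hB b hb; omega
  obtain ⟨B, hB⟩ := hb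
  refine ⟨B, ?_⟩
  ext v
  apply PL_disjoint h L (L.map (fun a => a + (B * (-2) : ℤ))) _ _ (hL _)
  · rw [PL_shift h (f ^ B) _ (pow_shift h f (-2) hf' B), hL, map_zero]
  · intro a ha hb
    obtain ⟨b, hb, h1⟩ := List.mem_map.1 hb
    have := hB a ha
    have := hB b hb
    omega

lemma ker_pl (e h f : Module.End F M) (hef : ∀ v, h (e v) = e (h v) + (2 : F) • e v)
    (hf' : ∀ v, h (f v) = f (h v) + ((-2 : ℤ) : F) • f v)
    (hf : ∀ v, e (f v) = f (e v) + h v) (k : ℕ) (v : M) (hv : f (e v) = 0) :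
    ∃ c : F, c ≠ 0 ∧ (e ^ k) ((f ^ k) v) = c • PL h ((List.range k).map (fun j : ℕ => (j : ℤ))) v := by
  induction k generalizing v with
  | zero => exact ⟨1, one_ne_zero, by simp [PL_nil]⟩
  | succ k ih =>
    have := fe_pow f (-h) e (by intro v; simp [hf']; module) (by intro v; simp [hf]) k v
    have h1 : f (e (h v - (k : F) • v)) = 0 := by
      have : e (h v) = h (e v) - (2 : F) • e v := by rw [hef]; simp
      rw [map_sub, this]
      have : f (h (e v)) = h (f (e v)) + (2 : F) • f (e v) := by rw [hf']; push_cast; module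
      simp [this, hv]
    obtain ⟨c, hc, ih⟩ := ih _ h1
    refine ⟨(k + 1) * c, mul_ne_zero (by exact_mod_cast Nat.succ_ne_zero k) hc, ?_⟩
    rw [this, List.range_succ, List.map_append, PL_append]
    have h2 : e (f v) - (k : F) • (-h) v - ((k : F) * (k + 1)) • v =
      ((k : F) + 1) • (h v - (k : F) • v) := by
      rw [hf, hv]; simp only [LinearMap.neg_apply]; module
    rw [h2, map_smul, map_smul, ih, smul_smul]
    simp [PL_cons, PL_nil]

lemma U_exists (e h f : Module.End F M) (he : ∀ v, h (e v) = e (h v) + (2 : F) • e v)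
    (hf' : ∀ v, h (f v) = f (h v) + ((-2 : ℤ) : F) • f v)
    (hf : ∀ v, e (f v) = f (e v) + h v) (k : ℕ) :
    ∃ U : Module.End F M, (∀ v, (f ^ (k + 1)) ((e ^ (k + 1)) v) = f (e (U v))) ∧
      (∀ v, h (U v) = U (h v)) ∧
      ∀ (z : M) (w : ℤ), 0 ≤ w → e z = 0 → h z = (w : F) • z → ∃ c : F, c ≠ 0 ∧ U z = c • z := by
  induction k with
  | zero => exact ⟨1, by simp, by simp, fun z w _ _ _ => ⟨1, one_ne_zero, by simp⟩⟩
  | succ k ih =>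
    obtain ⟨U, h1, h2, h3⟩ := ih
    refine ⟨U * (f * e - ((k + 1 : ℕ) : F) • h - (((k + 1 : ℕ) : F) * ((k + 1 : ℕ) + 1)) • 1),
      ?_, ?_, ?_⟩
    · intro v
      rw [fe_pow e h f he hf, h1]; simp
    · intro v
      rw [Module.End.mul_apply, h2, Module.End.mul_apply]
      congr 1
      simp only [LinearMap.sub_apply, LinearMap.smul_apply, map_sub, map_smul,
        Module.End.mul_apply, Module.End.one_apply, hf', he, map_add]
      push_cast
      module
    · intro z w hw ez hz
      obtain ⟨c, hc, h4⟩ := h3 z w hw ez hz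
      refine ⟨(-(((k + 1 : ℕ) : F) * (w + (k + 1 : ℕ) + 1))) * c, mul_ne_zero (neg_ne_zero.2
        (mul_ne_zero (by exact_mod_cast Nat.succ_ne_zero k) ?_)) hc, ?_⟩
      · have : w + (k + 1 : ℕ) + 1 ≠ 0 := by omega
        exact_mod_cast this
      · simp only [LinearMap.sub_apply, LinearMap.smul_apply, map_sub, map_smul,
          Module.End.mul_apply, Module.End.one_apply, ez, hz, h4, map_zero]
        push_cast
        module

lemma semis (e h f : Module.End F M) (he : ∀ v, h (e v) = e (h v) + (2 : F) • e v)
    (hf' : ∀ v, h (f v) = f (h v) + ((-2 : ℤ) : F) • f v)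
    (hf : ∀ v, e (f v) = f (e v) + h v) (N : ℕ) (hN : e ^ N = 0)
    (w : ℤ) (v z : M) (hv : h v = (w : F) • v + z) (hz : h z = (w : F) • z) : z = 0 := by
  obtain ⟨L, hL⟩ := exists_PL e h f he hf N hN
  obtain ⟨N', hN'⟩ := f_nilp h f hf' L hL
  have key : ∀ (m : ℕ) (w : ℤ) (v z : M), (e ^ m) v = 0 → h v = (w : F) • v + z →
      h z = (w : F) • z → z = 0 := by
    intro m
    induction m with
    | zero =>
      intro w v z h1 h2 h3
      have : v = 0 := by simpa using h1
      rw [this] at h2; simpa using h2.symm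
    | succ m ih =>
      intro w v z h1 h2 h3
      have ez : e z = 0 := by
        apply ih (w + 2) (e v) (e z)
        · rw [pow_succ] at h1; exact h1
        · rw [he, h2, map_add, map_smul]; push_cast; module
        · rw [he, h3, map_smul]; push_cast; module
      by_cases hw : 0 ≤ w
      · obtain ⟨U, u1, u2, u3⟩ := U_exists e h f he hf' hf N
        obtain ⟨c, hc, hUz⟩ := u3 z w hw ez h3
        have h4 : f (e (U v)) = 0 := by
          rw [← u1, pow_succ' e, hN]; simp
        obtain ⟨c', hc', h5⟩ := ker_pl e h f he hf' hf N' _ h4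
        rw [hN', LinearMap.zero_apply, map_zero] at h5
        have h6 := (smul_eq_zero.1 h5.symm).resolve_left hc'
        have := PL_nodup h _ (List.Nodup.map Nat.cast_injective List.nodup_range) w (U v) (U z)
          (by rw [u2, h2, map_add, map_smul]) (by rw [u2, h3, map_smul]) h6
        rw [hUz] at this
        exact (smul_eq_zero.1 this).resolve_left hc
      · obtain ⟨c', hc', h5⟩ := ker_pl e h f he hf' hf N' z (by rw [ez, map_zero])
        rw [hN', LinearMap.zero_apply, map_zero] at h5
        have h6 := (smul_eq_zero.1 h5.symm).resolve_left hc'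
        apply PL_eig_zero h _ w z h3 _ h6
        simp only [List.mem_map, not_exists, not_and]
        intro a _ ha
        omega
  exact key N w v z (by rw [hN]; rfl) hv hz

end Sl2

lemma sum_max_eq {J : Type*} (s : Finset J) (ω : J → ℤ) (K : ℤ) (hK : ∀ j ∈ s, ω j ≤ K) :
    ∑ j ∈ s, max (ω j) 0 = ∑ w ∈ Finset.Icc 1 K, w * ((s.filter (fun j => ω j = w)).card : ℤ) := by
  have h1 : ∀ j ∈ s, max (ω j) 0 = ∑ w ∈ Finset.Icc 1 K, if ω j = w then w else 0 := by
    intro j hj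
    rw [Finset.sum_ite_eq]
    have := hK j hj
    split_ifs with h
    · rw [Finset.mem_Icc] at h; omega
    · rw [Finset.mem_Icc] at h; omega
  rw [Finset.sum_congr rfl h1, Finset.sum_comm]
  refine Finset.sum_congr rfl fun w _ => ?_
  rw [← Finset.sum_filter, Finset.sum_const, nsmul_eq_mul, mul_comm]

lemma max_indic (K x y : ℤ) (hx : x ≤ K) (hy : -K ≤ y) :
    max (x - y) 0 = ∑ t ∈ Finset.Ico (-K) K,
      (if y ≤ t then (1 : ℤ) else 0) * (1 - if x ≤ t then (1 : ℤ) else 0) := by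
  have h1 : ∀ t ∈ Finset.Ico (-K) K,
      (if y ≤ t then (1 : ℤ) else 0) * (1 - if x ≤ t then (1 : ℤ) else 0)
      = if t ∈ Finset.Ico y x then 1 else 0 := by
    intro t _
    simp only [Finset.mem_Ico]
    split_ifs <;> omega
  rw [Finset.sum_congr rfl h1, ← Finset.sum_filter, Finset.sum_const, nsmul_eq_mul, mul_one]
  have : (Finset.Ico (-K) K).filter (fun t => t ∈ Finset.Ico y x) = Finset.Ico y x := by
    ext t
    simp only [Finset.mem_filter, Finset.mem_Ico]
    omega
  rw [this, Int.card_Ico]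
  omega

lemma sum_max_ind {n : ℕ} (K : ℤ) (a b : Fin n → ℤ) (ha : ∀ i, a i ≤ K) (hb : ∀ i, -K ≤ b i) :
    ∑ i, ∑ j, max (a i - b j) 0 = ∑ t ∈ Finset.Ico (-K) K,
      (∑ j, if b j ≤ t then (1 : ℤ) else 0) * (n - ∑ i, if a i ≤ t then (1 : ℤ) else 0) := by
  have h1 : ∀ i j, max (a i - b j) 0 = _ := fun i j => max_indic K (a i) (b j) (ha i) (hb j)
  simp_rw [h1]
  have h2 : ∀ i, ∑ j, ∑ t ∈ Finset.Ico (-K) K,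
      (if b j ≤ t then (1 : ℤ) else 0) * (1 - if a i ≤ t then (1 : ℤ) else 0) =
      ∑ t ∈ Finset.Ico (-K) K, ∑ j,
      (if b j ≤ t then (1 : ℤ) else 0) * (1 - if a i ≤ t then (1 : ℤ) else 0) :=
    fun i => Finset.sum_comm
  simp_rw [h2]
  rw [Finset.sum_comm]
  refine Finset.sum_congr rfl fun t _ => ?_
  simp_rw [← Finset.sum_mul, ← Finset.mul_sum]
  rw [Finset.sum_sub_distrib]
  simp

lemma energy {n : ℕ} (hn : 0 < n) (a b : Fin n → ℤ) :
    ∑ i, ∑ j, max (a i - a j) 0 + ∑ i, ∑ j, max (b i - b j) 0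
      - ∑ i, ∑ j, max (a i - b j - 2) 0 - ∑ i, ∑ j, max (b i - a j - 2) 0 < 2 * (n : ℤ) ^ 2 := by
  obtain ⟨K, hKa, hKa', hKb, hKb'⟩ : ∃ K : ℤ, (∀ i, a i < K) ∧ (∀ i, -K ≤ a i) ∧
      (∀ i, b i < K) ∧ (∀ i, -K ≤ b i) := by
    refine ⟨∑ i, |a i| + ∑ i, |b i| + 1, ?_⟩
    have h1 : ∀ i, |a i| ≤ ∑ i, |a i| := fun i =>
      Finset.single_le_sum (f := fun i => |a i|) (fun i _ => abs_nonneg _) (Finset.mem_univ i)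
    have h2 : ∀ i, |b i| ≤ ∑ i, |b i| := fun i =>
      Finset.single_le_sum (f := fun i => |b i|) (fun i _ => abs_nonneg _) (Finset.mem_univ i)
    have h3 : 0 ≤ ∑ i, |a i| := Finset.sum_nonneg fun i _ => abs_nonneg _
    have h4 : 0 ≤ ∑ i, |b i| := Finset.sum_nonneg fun i _ => abs_nonneg _
    refine ⟨fun i => ?_, fun i => ?_, fun i => ?_, fun i => ?_⟩
    · have := h1 i; have := le_abs_self (a i); omega
    · have := h1 i; have := neg_abs_le (a i); omega
    · have := h2 i; have := le_abs_self (b i); omega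
    · have := h2 i; have := neg_abs_le (b i); omega
  have haa := sum_max_ind K a a (fun i => (hKa i).le) hKa'
  have hbb := sum_max_ind K b b (fun i => (hKb i).le) hKb'
  have hab := sum_max_ind K a b (fun i => (hKa i).le) hKb'
  have hba := sum_max_ind K b a (fun i => (hKb i).le) hKa'
  set α : ℤ → ℤ := fun t => ∑ i, if a i ≤ t then (1 : ℤ) else 0 with hα
  set β : ℤ → ℤ := fun t => ∑ i, if b i ≤ t then (1 : ℤ) else 0 with hβ
  have hE : ∑ i, ∑ j, max (a i - a j) 0 + ∑ i, ∑ j, max (b i - b j) 0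
      - ∑ i, ∑ j, max (a i - b j) 0 - ∑ i, ∑ j, max (b i - a j) 0
      = - ∑ t ∈ Finset.Ico (-K) K, (α t - β t) ^ 2 := by
    rw [haa, hbb, hab, hba, ← Finset.sum_add_distrib, ← Finset.sum_sub_distrib,
      ← Finset.sum_sub_distrib, ← Finset.sum_neg_distrib]
    refine Finset.sum_congr rfl fun t _ => ?_
    simp only [hα, hβ]
    ring
  have hδ : ∑ i, ∑ j, max (a i - b j) 0 + ∑ i, ∑ j, max (b i - a j) 0
      + ∑ i, ∑ j, (if a i = b j then (2 : ℤ) else 0) - 2 * (n : ℤ) ^ 2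
      ≤ ∑ i, ∑ j, max (a i - b j - 2) 0 + ∑ i, ∑ j, max (b i - a j - 2) 0 := by
    have e1 : ∑ i, ∑ j, max (b i - a j) 0 = ∑ i, ∑ j, max (b j - a i) 0 := Finset.sum_comm
    have e2 : ∑ i, ∑ j, max (b i - a j - 2) 0 = ∑ i, ∑ j, max (b j - a i - 2) 0 :=
      Finset.sum_comm
    have e3 : 2 * (n : ℤ) ^ 2 = ∑ i : Fin n, ∑ j : Fin n, (2 : ℤ) := by simp; ring
    rw [e1, e2, e3]
    simp_rw [← Finset.sum_add_distrib, ← Finset.sum_sub_distrib]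
    refine Finset.sum_le_sum fun i _ => Finset.sum_le_sum fun j _ => ?_
    split_ifs <;> omega
  have hs1 : 0 ≤ ∑ t ∈ Finset.Ico (-K) K, (α t - β t) ^ 2 :=
    Finset.sum_nonneg fun t _ => sq_nonneg _
  have hs2 : 0 ≤ ∑ i, ∑ j, (if a i = b j then (2 : ℤ) else 0) :=
    Finset.sum_nonneg fun i _ => Finset.sum_nonneg fun j _ => by split_ifs <;> norm_num
  suffices 0 < ∑ t ∈ Finset.Ico (-K) K, (α t - β t) ^ 2 +
      ∑ i, ∑ j, (if a i = b j then (2 : ℤ) else 0) by linarith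
  by_cases hex : ∃ i j, a i = b j
  · obtain ⟨i, j, hij⟩ := hex
    have : 0 < ∑ i, ∑ j, (if a i = b j then (2 : ℤ) else 0) := by
      refine Finset.sum_pos' (fun i _ => Finset.sum_nonneg fun j _ => by split_ifs <;> norm_num)
        ⟨i, Finset.mem_univ _, ?_⟩
      exact Finset.sum_pos' (fun j _ => by split_ifs <;> norm_num)
        ⟨j, Finset.mem_univ _, by simp [hij]⟩
    linarith
  · push Not at hex
    have aux : ∀ (a b : Fin n → ℤ) (i0 : Fin n), (∀ j, a i0 < b j) →
        (∑ i, if b i ≤ a i0 then (1 : ℤ) else 0) < ∑ i, if a i ≤ a i0 then (1 : ℤ) else 0 := by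
      intro a b i0 h
      rw [Finset.sum_eq_zero (fun i _ => by rw [if_neg (not_le.2 (h i))])]
      exact Finset.sum_pos' (fun j _ => by split_ifs <;> norm_num)
        ⟨i0, Finset.mem_univ _, by simp⟩
    have hne : Nonempty (Fin n) := ⟨⟨0, hn⟩⟩
    obtain ⟨i0, hi0⟩ := Finite.exists_min a
    obtain ⟨j0, hj0⟩ := Finite.exists_min b
    have : 0 < ∑ t ∈ Finset.Ico (-K) K, (α t - β t) ^ 2 := by
      rcases lt_or_gt_of_ne (hex i0 j0) with h | h
      · refine Finset.sum_pos' (fun t _ => sq_nonneg _)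
          ⟨a i0, Finset.mem_Ico.2 ⟨hKa' i0, hKa i0⟩, ?_⟩
        have := aux a b i0 (fun j => lt_of_lt_of_le h (hj0 j))
        simp only [hα, hβ]
        exact pow_pos (by linarith) 2
      · refine Finset.sum_pos' (fun t _ => sq_nonneg _)
          ⟨b j0, Finset.mem_Ico.2 ⟨hKb' j0, hKb j0⟩, ?_⟩
        have := aux b a j0 (fun j => lt_of_lt_of_le h (hi0 j))
        simp only [hα, hβ]
        rw [← neg_sq]
        exact pow_pos (by linarith) 2
    linarith

section Mat
variable {F V ι : Type*} [Field F] [CharZero F] [AddCommGroup V] [Module F V]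
  [Fintype ι] [DecidableEq ι]

/-- endomorphisms whose matrix is supported on `S` -/
def Supp (b : Module.Basis ι F V) (S : ι × ι → Prop) : Submodule F (Module.End F V) where
  carrier := {A | ∀ p, ¬ S p → LinearMap.toMatrix b b A p.1 p.2 = 0}
  add_mem' := by
    intro A B hA hB p hp
    rw [map_add, Matrix.add_apply, hA p hp, hB p hp, add_zero]
  zero_mem' := by intro p _; simp
  smul_mem' := by
    intro c A hA p hp
    rw [map_smul, Matrix.smul_apply, hA p hp, smul_zero]

lemma mem_Supp (b : Module.Basis ι F V) (S : ι × ι → Prop) (A : Module.End F V) :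
    A ∈ Supp b S ↔ ∀ p, ¬ S p → LinearMap.toMatrix b b A p.1 p.2 = 0 := Iff.rfl

/-- truncation to `S` -/
noncomputable def trunc (b : Module.Basis ι F V) (S : ι × ι → Prop) [DecidablePred S]
    (g : ι × ι → F) : Module.End F V :=
  (LinearMap.toMatrix b b).symm (Matrix.of fun i j => if S (i, j) then g (i, j) else 0)

lemma trunc_mat (b : Module.Basis ι F V) (S : ι × ι → Prop) [DecidablePred S]
    (g : ι × ι → F) (i j : ι) :
    LinearMap.toMatrix b b (trunc b S g) i j = if S (i, j) then g (i, j) else 0 := by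
  simp [trunc]

lemma finrank_Supp (b : Module.Basis ι F V) (S : ι × ι → Prop) [DecidablePred S] :
    Module.finrank F (Supp b S) = (Finset.univ.filter S).card := by
  let φ : Supp b S →ₗ[F] ({p : ι × ι // S p} → F) :=
    { toFun := fun A p => LinearMap.toMatrix b b A.1 p.1.1 p.1.2
      map_add' := by intro A B; ext p; simp
      map_smul' := by intro c A; ext p; simp }
  have hφ : ∀ A p, φ A p = LinearMap.toMatrix b b A.1 p.1.1 p.1.2 := fun _ _ => rfl
  clear_value φ
  have hb : Function.Bijective φ := by
    constructor
    · rw [← LinearMap.ker_eq_bot, LinearMap.ker_eq_bot']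
      intro A hA
      apply Subtype.ext
      apply (LinearMap.toMatrix b b).injective
      ext i j
      by_cases h : S (i, j)
      · have := congrFun hA ⟨(i, j), h⟩
        rw [hφ] at this
        simpa using this
      · simpa using A.2 (i, j) h
    · intro g
      refine ⟨⟨trunc b S (fun p => if h : S p then g ⟨p, h⟩ else 0), ?_⟩, ?_⟩
      · intro p hp
        rw [trunc_mat, if_neg hp]
      · ext p
        rw [hφ]
        simp only [trunc_mat]
        rw [ if_pos p.2, dif_pos p.2]
  rw [(LinearEquiv.ofBijective φ hb).finrank_eq, Module.finrank_fintype_fun_eq_card,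
    Fintype.card_subtype]

lemma mat_d (b : Module.Basis ι F V) (u : ι → ℤ) (d : Module.End F V)
    (hd : ∀ i, d (b i) = (u i : F) • b i) :
    LinearMap.toMatrix b b d = Matrix.diagonal (fun i => (u i : F)) := by
  ext i j
  rw [LinearMap.toMatrix_apply, hd, map_smul, Matrix.diagonal_apply]
  simp only [Module.Basis.repr_self, Finsupp.smul_apply, Finsupp.single_apply, smul_eq_mul]
  by_cases h : i = j
  · subst h; simp
  · simp [h, Ne.symm h]

lemma mat_ad (b : Module.Basis ι F V) (u : ι → ℤ) (d : Module.End F V)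
    (hd : ∀ i, d (b i) = (u i : F) • b i) (A : Module.End F V) (i j : ι) :
    LinearMap.toMatrix b b (d * A - A * d) i j =
      ((u i : F) - u j) * LinearMap.toMatrix b b A i j := by
  rw [map_sub, LinearMap.toMatrix_mul, LinearMap.toMatrix_mul, mat_d b u d hd]
  simp only [Matrix.sub_apply, Matrix.diagonal_mul, Matrix.mul_diagonal]
  ring

/-- adjoint action -/
def adE (A : Module.End F V) : Module.End F (Module.End F V) :=
  LinearMap.mulLeft F A - LinearMap.mulRight F A

lemma adE_apply (A B : Module.End F V) : adE A B = A * B - B * A := rfl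

lemma adE_nilp (A : Module.End F V) (hA : IsNilpotent A) : IsNilpotent (adE A) :=
  (LinearMap.commute_mulLeft_right A A).isNilpotent_sub
    ((LinearMap.isNilpotent_mulLeft_iff F A).2 hA) ((LinearMap.isNilpotent_mulRight_iff F A).2 hA)

lemma mat_adx (b : Module.Basis ι F V) (x A : Module.End F V) (i j : ι) :
    LinearMap.toMatrix b b (adE x A) i j =
      ∑ k, (LinearMap.toMatrix b b x i k * LinearMap.toMatrix b b A k j -
        LinearMap.toMatrix b b A i k * LinearMap.toMatrix b b x k j) := by
  rw [adE_apply, map_sub, LinearMap.toMatrix_mul, LinearMap.toMatrix_mul, Matrix.sub_apply,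
    Matrix.mul_apply, Matrix.mul_apply, Finset.sum_sub_distrib]

lemma dim_bound (b : Module.Basis ι F V) (u : ι → ℤ) (σ : ι → Bool)
    (x d xm : Module.End F V) (hd : ∀ i, d (b i) = (u i : F) • b i)
    (hx : ∀ i j, LinearMap.toMatrix b b x i j ≠ 0 → u i = u j + 2 ∧ σ i ≠ σ j)
    (he : ∀ A, adE d (adE x A) = adE x (adE d A) + (2 : F) • adE x A)
    (hf : ∀ A, adE x (adE xm A) = adE xm (adE x A) + adE d A)
    (hnil : IsNilpotent x) (w : ℤ) (hw : 1 ≤ w)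
    {κ : Type*} [Fintype κ] (c : κ → Module.End F V) (hc : LinearIndependent F c)
    (hc1 : ∀ k, c k ∈ Supp b (fun p => u p.1 - u p.2 = w ∧ σ p.1 = σ p.2))
    (hc2 : ∀ k, adE x (c k) = 0) :
    Fintype.card κ +
      (Finset.univ.filter (fun p : ι × ι => u p.1 - u p.2 = w + 2 ∧ σ p.1 ≠ σ p.2)).card ≤
      (Finset.univ.filter (fun p : ι × ι => u p.1 - u p.2 = w ∧ σ p.1 = σ p.2)).card := by
  have f0 := finrank_Supp b (fun p : ι × ι => u p.1 - u p.2 = w ∧ σ p.1 = σ p.2)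
  have f1 := finrank_Supp b (fun p : ι × ι => u p.1 - u p.2 = w + 2 ∧ σ p.1 ≠ σ p.2)
  rw [← f0, ← f1]
  clear f0 f1
  classical
  set S0 : ι × ι → Prop := fun p => u p.1 - u p.2 = w ∧ σ p.1 = σ p.2 with hS0
  set S1 : ι × ι → Prop := fun p => u p.1 - u p.2 = w + 2 ∧ σ p.1 ≠ σ p.2 with hS1
  have hfin : FiniteDimensional F V := Module.Finite.of_basis b
  have r1 : ∀ i j k, LinearMap.toMatrix b b x i k ≠ 0 → (S0 (k, j) ↔ S1 (i, j)) := by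
    intro i j k h
    obtain ⟨h1, h2⟩ := hx i k h
    simp only [hS0, hS1]
    revert h2
    cases σ i <;> cases σ j <;> cases σ k <;> simp <;> omega
  have r2 : ∀ i j k, LinearMap.toMatrix b b x k j ≠ 0 → (S0 (i, k) ↔ S1 (i, j)) := by
    intro i j k h
    obtain ⟨h1, h2⟩ := hx k j h
    simp only [hS0, hS1]
    revert h2
    cases σ i <;> cases σ j <;> cases σ k <;> simp <;> omega
  have hmaps : ∀ A ∈ Supp b S0, adE x A ∈ Supp b S1 := by
    intro A hA p hp
    rw [mat_adx]
    refine Finset.sum_eq_zero fun k _ => ?_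
    have e1 : LinearMap.toMatrix b b x p.1 k * LinearMap.toMatrix b b A k p.2 = 0 := by
      by_cases h : LinearMap.toMatrix b b x p.1 k = 0
      · rw [h, zero_mul]
      · rw [hA (k, p.2) (fun h' => hp ((r1 _ _ _ h).1 h')), mul_zero]
    have e2 : LinearMap.toMatrix b b A p.1 k * LinearMap.toMatrix b b x k p.2 = 0 := by
      by_cases h : LinearMap.toMatrix b b x k p.2 = 0
      · rw [h, mul_zero]
      · rw [hA (p.1, k) (fun h' => hp ((r2 _ _ _ h).1 h')), zero_mul]
    rw [e1, e2, sub_zero]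
  let φ : Supp b S0 →ₗ[F] Supp b S1 := (adE x).restrict hmaps
  have hφ : ∀ A, (φ A : Module.End F V) = adE x A := fun _ => rfl
  clear_value φ
  have hsurj : Function.Surjective φ := by
    rintro ⟨B, hB⟩
    obtain ⟨N, hN⟩ := adE_nilp x hnil
    have hBe : adE d B = ((w + 2 : ℤ) : F) • B := by
      apply (LinearMap.toMatrix b b).injective
      ext i j
      rw [adE_apply, mat_ad b u d hd, map_smul, Matrix.smul_apply, smul_eq_mul]
      by_cases h : S1 (i, j)
      · rw [← h.1]; push_cast; rfl
      · rw [hB (i, j) h]; simp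
    have h1 := image_pl (adE x) (adE d) (adE xm) he hf N hN B
    rw [PL_eig _ _ _ _ hBe] at h1
    have h2 : ((((Lneg N).map (fun a => w + 2 - a)).prod : ℤ) : F) ≠ 0 := by
      rw [Int.cast_ne_zero, Ne, List.prod_eq_zero_iff]
      simp only [Lneg, List.map_map, List.mem_map, not_exists, not_and, Function.comp]
      intro a _ h
      omega
    have h3 : B ∈ LinearMap.range (adE x) := (Submodule.smul_mem_iff _ h2).1 h1
    obtain ⟨A, hA⟩ := h3
    refine ⟨⟨trunc b S0 (fun p => LinearMap.toMatrix b b A p.1 p.2), ?_⟩, ?_⟩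
    · intro p hp
      rw [trunc_mat, if_neg hp]
    · apply Subtype.ext
      apply (LinearMap.toMatrix b b).injective
      ext i j
      rw [hφ]
      dsimp only
      by_cases h : S1 (i, j)
      · rw [← hA, mat_adx, mat_adx]
        refine Finset.sum_congr rfl fun k _ => ?_
        simp only [trunc_mat]
        congr 1
        · by_cases h' : LinearMap.toMatrix b b x i k = 0
          · rw [h', zero_mul, zero_mul]
          · rw [if_pos ((r1 _ _ _ h').2 h)]
        · by_cases h' : LinearMap.toMatrix b b x k j = 0
          · rw [h', mul_zero, mul_zero]
          · rw [if_pos ((r2 _ _ _ h').2 h)]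
      · rw [hB (i, j) h]
        exact hmaps _ (by intro p hp; rw [trunc_mat, if_neg hp]) (i, j) h
  have hrn := LinearMap.finrank_range_add_finrank_ker φ
  rw [LinearMap.range_eq_top.2 hsurj, finrank_top] at hrn
  let c' : κ → LinearMap.ker φ := fun k => ⟨⟨c k, hc1 k⟩, by
    rw [LinearMap.mem_ker]; exact Subtype.ext ((hφ _).trans (hc2 k))⟩
  have hc' : LinearIndependent F c' := by
    apply LinearIndependent.of_comp ((Supp b S0).subtype ∘ₗ (LinearMap.ker φ).subtype)
    exact hc
  have := hc'.fintype_card_le_finrank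
  omega

end Mat

lemma exists_basis_fin {F M : Type*} [Field F] [AddCommGroup M] [Module F M]
    [FiniteDimensional F M] (P : M → Prop) (h : Submodule.span F {v | P v} = ⊤) :
    ∃ b : Module.Basis (Fin (Module.finrank F M)) F M, ∀ i, P (b i) := by
  let B := Module.Basis.ofSpan h.ge
  have hB : ∀ i, P (B i) := fun i => Module.Basis.ofSpan_subset h.ge ⟨i, rfl⟩
  have : Finite _ := Module.Finite.finite_basis B
  have := Fintype.ofFinite ((linearIndepOn_empty F id).extend (Set.empty_subset {v | P v}) : Set _)
  have hc := Module.finrank_eq_card_basis B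
  refine ⟨B.reindex (Fintype.equivFinOfCardEq hc.symm), fun i => ?_⟩
  rw [Module.Basis.reindex_apply]
  exact hB _

lemma exists_basis_eig {F : Type*} [Field F] {n : ℕ} (P : (Fin n → F) → Prop)
    (h : Submodule.span F {v | P v} = ⊤) :
    ∃ b : Module.Basis (Fin n) F (Fin n → F), ∀ i, P (b i) := by
  obtain ⟨b, hb⟩ := exists_basis_fin P h
  refine ⟨b.reindex (finCongr (Module.finrank_fin_fun F)), fun i => ?_⟩
  rw [Module.Basis.reindex_apply]
  exact hb _

lemma adE_jac {F V : Type*} [Field F] [CharZero F] [AddCommGroup V] [Module F V]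
    (a b A : Module.End F V) :
    adE a (adE b A) = adE b (adE a A) + adE (a * b - b * a) A := by
  simp only [adE_apply, mul_sub, sub_mul, mul_assoc]
  abel

lemma trace_eig {F M κ : Type*} [Field F] [CharZero F] [AddCommGroup M] [Module F M] [Fintype κ]
    [DecidableEq κ] (c : Module.Basis κ F M) (g : Module.End F M) (w : κ → ℤ)
    (hw : ∀ k, g (c k) = (w k : F) • c k) :
    LinearMap.trace F M g = ((∑ k, w k : ℤ) : F) := by
  rw [LinearMap.trace_eq_matrix_trace F c, mat_d c w g hw, Matrix.trace_diagonal]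
  push_cast; rfl

lemma adE_neg_two {F V : Type*} [Field F] [CharZero F] [AddCommGroup V] [Module F V]
    (y A : Module.End F V) : adE (-(2 • y)) A = ((-2 : ℤ) : F) • adE y A := by
  rw [Int.cast_neg, neg_smul, Int.cast_ofNat]
  simp only [adE_apply, two_smul, add_mul, mul_add, neg_mul, mul_neg, neg_add]
  abel

lemma bound_C {F V ι κ : Type*} [Field F] [CharZero F] [AddCommGroup V] [Module F V]
    [Fintype ι] [DecidableEq ι] [Fintype κ] [DecidableEq κ]
    (b : Module.Basis ι F V) (u : ι → ℤ) (σ : ι → Bool) (x d xm : Module.End F V)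
    (hd : ∀ i, d (b i) = (u i : F) • b i)
    (hx : ∀ i j, LinearMap.toMatrix b b x i j ≠ 0 → u i = u j + 2 ∧ σ i ≠ σ j)
    (he : ∀ A, adE d (adE x A) = adE x (adE d A) + (2 : F) • adE x A)
    (hf : ∀ A, adE x (adE xm A) = adE xm (adE x A) + adE d A)
    (hnil : IsNilpotent x) (C : Submodule F (Module.End F V))
    (c : Module.Basis κ F C) (w : κ → ℤ)
    (hcS : ∀ k, (c k : Module.End F V) ∈
      Supp b (fun p => u p.1 - u p.2 = w k ∧ σ p.1 = σ p.2))
    (hcx : ∀ k, adE x (c k : Module.End F V) = 0) (W : ℤ) (hW : 1 ≤ W) :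
    (Finset.univ.filter (fun k => w k = W)).card +
      (Finset.univ.filter (fun p : ι × ι => u p.1 - u p.2 = W + 2 ∧ σ p.1 ≠ σ p.2)).card ≤
      (Finset.univ.filter (fun p : ι × ι => u p.1 - u p.2 = W ∧ σ p.1 = σ p.2)).card := by
  have hli : LinearIndependent F (fun k : κ => (c k : Module.End F V)) :=
    c.linearIndependent.map' C.subtype C.ker_subtype
  have hli2 : LinearIndependent F (fun k : {k // w k = W} => (c k.1 : Module.End F V)) :=
    hli.comp _ Subtype.val_injective
  have := dim_bound b u σ x d xm hd hx he hf hnil W hW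
      (κ := {k // w k = W}) (fun k => (c k.1 : Module.End F V)) hli2
      (fun k => by have := hcS k.1; rwa [k.2] at this)
      (fun k => hcx k.1)
  rwa [Fintype.card_subtype] at this

set_option maxHeartbeats 2000000 in
theorem stmt13 {F : Type*} [Field F] [CharZero F] (n : ℕ) (hn : 0 < n)
    (ε : Module.End F ((Fin n → F) × (Fin n → F)))
    (hε : ∀ p : (Fin n → F) × (Fin n → F), ε p = (p.1, -p.2))
    (x d xm : Module.End F ((Fin n → F) × (Fin n → F)))
    (hdx : d * x - x * d = 2 • x)
    (hdxm : d * xm - xm * d = -(2 • xm))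
    (hxxm : x * xm - xm * x = d)
    (hxnil : IsNilpotent x)
    (hxodd : ε * x * ε = -x)
    (hdeven : ε * d = d * ε)
    -- the centralizer of x in gl_n × gl_n (the even part of End)
    (C : Submodule F (Module.End F ((Fin n → F) × (Fin n → F))))
    (hC : ∀ A, A ∈ C ↔ (ε * A = A * ε ∧ A * x = x * A))
    -- the adjoint action of d
    (D : Module.End F (Module.End F ((Fin n → F) × (Fin n → F))))
    (hD : ∀ A, D A = d * A - A * d)
    (hCinv : ∀ A ∈ C, D A ∈ C) :
    ∃ m : ℤ, LinearMap.trace F _ (D.restrict hCinv) = (m : F) ∧ m < 2 * n ^ 2 := by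
  classical
  -- sl2 relations on V
  have v1 : ∀ v, d (x v) = x (d v) + (2 : F) • x v := by
    intro v
    have := LinearMap.congr_fun hdx v
    simp only [LinearMap.sub_apply, Module.End.mul_apply, LinearMap.smul_apply] at this
    rw [sub_eq_iff_eq_add'] at this
    rw [this]; simp only [two_smul]
  have v2 : ∀ v, d (xm v) = xm (d v) + ((-2 : ℤ) : F) • xm v := by
    intro v
    have := LinearMap.congr_fun hdxm v
    simp only [LinearMap.sub_apply, Module.End.mul_apply, LinearMap.smul_apply,
      LinearMap.neg_apply] at this
    rw [sub_eq_iff_eq_add'] at this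
    rw [this, Int.cast_neg, neg_smul, Int.cast_ofNat]; simp only [two_smul]
  have v3 : ∀ v, x (xm v) = xm (x v) + d v := by
    intro v
    have := LinearMap.congr_fun hxxm v
    simp only [LinearMap.sub_apply, Module.End.mul_apply] at this
    rw [← this]; simp
  -- sl2 relations on End V
  have hDad : D = adE d := by ext1 A; rw [hD, adE_apply]
  have e1 : ∀ A, adE d (adE x A) = adE x (adE d A) + (2 : F) • adE x A := by
    intro A
    rw [adE_jac, hdx]
    simp only [adE_apply, two_smul, add_mul, mul_add]
    abel
  have e2 : ∀ A, adE d (adE xm A) = adE xm (adE d A) + ((-2 : ℤ) : F) • adE xm A := by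
    intro A
    rw [adE_jac, hdxm, adE_neg_two]
  have e3 : ∀ A, adE x (adE xm A) = adE xm (adE x A) + adE d A := by
    intro A
    rw [adE_jac, hxxm]
  -- eigenbasis of V
  have hspan : Submodule.span F {v | ∃ w : ℤ, d v = (w : F) • v} = ⊤ := by
    obtain ⟨N, hN⟩ := hxnil
    obtain ⟨L, hL⟩ := exists_PL x d xm v1 v3 N hN
    exact span_eig d L hL (semis x d xm v1 v2 v3 N hN)
  have hdε : ∀ v, ε (d v) = d (ε v) := fun v => LinearMap.congr_fun hdeven v
  have hfst : ∀ v (w : ℤ), d v = (w : F) • v → d (v.1, 0) = (w : F) • ((v.1, 0) : (Fin n → F) × (Fin n → F)) := by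
    intro v w hv
    have h2 : ((v.1, 0) : (Fin n → F) × (Fin n → F)) = (2 : F)⁻¹ • (v + ε v) := by
      rw [hε]; ext i <;> simp <;> ring
    rw [h2, map_smul, map_add, ← hdε, hv, map_smul]; module
  have hsnd : ∀ v (w : ℤ), d v = (w : F) • v → d (0, v.2) = (w : F) • ((0, v.2) : (Fin n → F) × (Fin n → F)) := by
    intro v w hv
    have h2 : ((0, v.2) : (Fin n → F) × (Fin n → F)) = (2 : F)⁻¹ • (v - ε v) := by
      rw [hε]; ext i <;> simp <;> ring
    rw [h2, map_smul, map_sub, ← hdε, hv, map_smul]; module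
  obtain ⟨b0, hb0⟩ := exists_basis_eig (F := F) (n := n)
    (fun p => ∃ w : ℤ, d (p, 0) = (w : F) • ((p, 0) : (Fin n → F) × (Fin n → F))) (by
      rw [eq_top_iff, ← LinearMap.range_eq_top.2 (LinearMap.fst_surjective (R := F)
        (M := Fin n → F) (M₂ := Fin n → F)), LinearMap.range_eq_map, ← hspan, Submodule.map_span]
      apply Submodule.span_mono
      rintro _ ⟨v, ⟨w, hw⟩, rfl⟩
      exact ⟨w, hfst v w hw⟩)
  obtain ⟨b1, hb1⟩ := exists_basis_eig (F := F) (n := n)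
    (fun p => ∃ w : ℤ, d (0, p) = (w : F) • ((0, p) : (Fin n → F) × (Fin n → F))) (by
      rw [eq_top_iff, ← LinearMap.range_eq_top.2 (LinearMap.snd_surjective (R := F)
        (M := Fin n → F) (M₂ := Fin n → F)), LinearMap.range_eq_map, ← hspan, Submodule.map_span]
      apply Submodule.span_mono
      rintro _ ⟨v, ⟨w, hw⟩, rfl⟩
      exact ⟨w, hsnd v w hw⟩)
  choose u0 hu0 using hb0
  choose u1 hu1 using hb1
  let b := b0.prod b1
  let u : Fin n ⊕ Fin n → ℤ := Sum.elim u0 u1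
  let σ : Fin n ⊕ Fin n → Bool := Sum.isLeft
  let s : Fin n ⊕ Fin n → ℤ := Sum.elim (fun _ => 1) (fun _ => -1)
  have hbd : ∀ i, d (b i) = (u i : F) • b i := by
    rintro (i | i)
    · have : b (Sum.inl i) = (b0 i, 0) := by
        simp [b, Module.Basis.prod_apply]
      rw [this]; exact hu0 i
    · have : b (Sum.inr i) = (0, b1 i) := by
        simp [b, Module.Basis.prod_apply]
      rw [this]; exact hu1 i
  have hbε : ∀ i, ε (b i) = (s i : F) • b i := by
    rintro (i | i)
    · have : b (Sum.inl i) = (b0 i, 0) := by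
        simp [b, Module.Basis.prod_apply]
      rw [this, hε]; simp [s]
    · have : b (Sum.inr i) = (0, b1 i) := by
        simp [b, Module.Basis.prod_apply]
      rw [this, hε]; simp [s]
  clear_value b
  have hx : ∀ i j, LinearMap.toMatrix b b x i j ≠ 0 → u i = u j + 2 ∧ σ i ≠ σ j := by
    intro i j hij
    constructor
    · have h1 := mat_ad b u d hbd x i j
      rw [hdx, map_nsmul, Matrix.smul_apply, nsmul_eq_mul] at h1
      have h2 := mul_right_cancel₀ hij h1
      have h3 : ((u i : ℤ) : F) = ((u j + 2 : ℤ) : F) := by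
        push_cast at h2 ⊢; linear_combination -h2
      exact_mod_cast h3
    · have h1 := congrArg (fun A => LinearMap.toMatrix b b A i j) hxodd
      simp only [LinearMap.toMatrix_mul, mat_d b s ε hbε, map_neg, Matrix.neg_apply,
        Matrix.mul_diagonal, Matrix.diagonal_mul] at h1
      have h2 : ((s i : F) * s j + 1) * LinearMap.toMatrix b b x i j = 0 := by
        linear_combination h1
      have h3 := (mul_eq_zero.1 h2).resolve_right hij
      rcases i with i | i <;> rcases j with j | j <;> simp [s, σ] at h3 ⊢ <;> norm_num at h3
  -- eigenbasis of C
  let g := D.restrict hCinv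
  have hg : ∀ A : C, ((g A : C) : Module.End F ((Fin n → F) × (Fin n → F))) = adE d A := by
    intro A; rw [← hDad]; rfl
  change ∃ m : ℤ, LinearMap.trace F _ g = (m : F) ∧ m < 2 * n ^ 2
  clear_value g
  have hspanC : Submodule.span F {v | ∃ w : ℤ, g v = (w : F) • v} = ⊤ := by
    obtain ⟨N, hN⟩ := adE_nilp x hxnil
    obtain ⟨L, hL⟩ := exists_PL (adE x) (adE d) (adE xm) e1 e3 N hN
    have hPL : ∀ (L : List ℤ) (A : C), ((PL g L A : C) : Module.End F ((Fin n → F) × (Fin n → F))) = PL (adE d) L A := by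
      intro L A
      induction L with
      | nil => rfl
      | cons a L ih => simp [PL_cons, hg, ih]
    refine span_eig g L (fun A => Subtype.ext ((hPL L A).trans (hL _))) ?_
    intro w v z h1 h2
    apply Subtype.ext
    refine semis (adE x) (adE d) (adE xm) e1 e2 e3 N hN w v z ?_ ?_
    · rw [← hg, h1]; rfl
    · rw [← hg, h2]; rfl
  obtain ⟨c, hc⟩ := exists_basis_fin (F := F) (M := C)
    (fun v => ∃ w : ℤ, g v = (w : F) • v) hspanC
  choose w hw using hc
  refine ⟨∑ k, w k, trace_eig (F := F) (M := C) c g w hw, ?_⟩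
  have hcS : ∀ k, (c k : Module.End F _) ∈
      Supp b (fun p => u p.1 - u p.2 = w k ∧ σ p.1 = σ p.2) := by
    intro k p hp
    by_contra hne
    apply hp
    constructor
    · have h1 := mat_ad b u d hbd (c k) p.1 p.2
      rw [← adE_apply, ← hg, hw, Submodule.coe_smul, map_smul, Matrix.smul_apply, smul_eq_mul] at h1
      have h2 := mul_right_cancel₀ hne h1
      exact_mod_cast h2.symm
    · have h1 := congrArg (fun A => LinearMap.toMatrix b b A p.1 p.2) ((hC _).1 (c k).2).1
      simp only [LinearMap.toMatrix_mul, mat_d b s ε hbε,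
        Matrix.mul_diagonal, Matrix.diagonal_mul] at h1
      rw [mul_comm] at h1
      have h3 := mul_left_cancel₀ hne h1
      obtain ⟨i, j⟩ := p
      have h4 : s i = s j := by exact_mod_cast h3
      rcases i with i | i <;> rcases j with j | j <;> simp [s, σ] at h4 ⊢
  have hcx : ∀ k, adE x (c k : Module.End F _) = 0 := fun k => by
    rw [adE_apply, ((hC _).1 (c k).2).2, sub_self]
  have hbound : ∀ W : ℤ, 1 ≤ W → (Finset.univ.filter (fun k => w k = W)).card +
      (Finset.univ.filter (fun p : (Fin n ⊕ Fin n) × (Fin n ⊕ Fin n) =>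
        u p.1 - u p.2 = W + 2 ∧ σ p.1 ≠ σ p.2)).card ≤
      (Finset.univ.filter (fun p : (Fin n ⊕ Fin n) × (Fin n ⊕ Fin n) =>
        u p.1 - u p.2 = W ∧ σ p.1 = σ p.2)).card := by
    intro W hW
    exact bound_C b u σ x d xm hbd hx e1 e3 hxnil C c w hcS hcx W hW
  obtain ⟨K, hK1, hK2⟩ : ∃ K : ℤ, (∀ k, w k ≤ K) ∧
      (∀ p : (Fin n ⊕ Fin n) × (Fin n ⊕ Fin n), u p.1 - u p.2 ≤ K) := by
    refine ⟨∑ k, |w k| + ∑ p : (Fin n ⊕ Fin n) × (Fin n ⊕ Fin n), |u p.1 - u p.2|, ?_, ?_⟩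
    · intro k
      have h1 := Finset.single_le_sum (f := fun k => |w k|) (fun i _ => abs_nonneg _)
        (Finset.mem_univ k)
      have h2 : 0 ≤ ∑ p : (Fin n ⊕ Fin n) × (Fin n ⊕ Fin n), |u p.1 - u p.2| :=
        Finset.sum_nonneg fun i _ => abs_nonneg _
      have := le_abs_self (w k)
      linarith
    · intro p
      have h1 := Finset.single_le_sum
        (f := fun p : (Fin n ⊕ Fin n) × (Fin n ⊕ Fin n) => |u p.1 - u p.2|)
        (fun i _ => abs_nonneg _) (Finset.mem_univ p)
      have h2 : 0 ≤ ∑ k, |w k| := Finset.sum_nonneg fun i _ => abs_nonneg _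
      have := le_abs_self (u p.1 - u p.2)
      linarith
  have t1 := sum_max_eq Finset.univ w K (fun k _ => hK1 k)
  have t2 := sum_max_eq (Finset.univ.filter
    (fun p : (Fin n ⊕ Fin n) × (Fin n ⊕ Fin n) => σ p.1 = σ p.2)) (fun p => u p.1 - u p.2) K
    (fun p _ => hK2 p)
  have t3 := sum_max_eq (Finset.univ.filter
    (fun p : (Fin n ⊕ Fin n) × (Fin n ⊕ Fin n) => σ p.1 ≠ σ p.2)) (fun p => u p.1 - u p.2 - 2) K
    (fun p _ => by have := hK2 p; omega)
  have t4 : ∑ k, w k ≤ ∑ k, max (w k) 0 := Finset.sum_le_sum fun k _ => le_max_left _ _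
  have t5 : ∑ k, max (w k) 0 + ∑ p ∈ (Finset.univ.filter
      (fun p : (Fin n ⊕ Fin n) × (Fin n ⊕ Fin n) => σ p.1 ≠ σ p.2)), max (u p.1 - u p.2 - 2) 0 ≤
      ∑ p ∈ (Finset.univ.filter
      (fun p : (Fin n ⊕ Fin n) × (Fin n ⊕ Fin n) => σ p.1 = σ p.2)), max (u p.1 - u p.2) 0 := by
    rw [t1, t2, t3, ← Finset.sum_add_distrib]
    refine Finset.sum_le_sum fun W hW => ?_
    have hW1 := (Finset.mem_Icc.1 hW).1
    rw [← mul_add]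
    apply mul_le_mul_of_nonneg_left _ (by omega)
    have := hbound W hW1
    rw [Finset.filter_filter, Finset.filter_filter]
    have r1 : (Finset.univ.filter (fun p : (Fin n ⊕ Fin n) × (Fin n ⊕ Fin n) =>
        u p.1 - u p.2 = W + 2 ∧ σ p.1 ≠ σ p.2)) = (Finset.univ.filter
        (fun p : (Fin n ⊕ Fin n) × (Fin n ⊕ Fin n) =>
        σ p.1 ≠ σ p.2 ∧ u p.1 - u p.2 - 2 = W)) := by
      ext p
      simp only [Finset.mem_filter, Finset.mem_univ, true_and]
      rw [and_comm]
      apply and_congr_right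
      intro _
      omega
    have r2 : (Finset.univ.filter (fun p : (Fin n ⊕ Fin n) × (Fin n ⊕ Fin n) =>
        u p.1 - u p.2 = W ∧ σ p.1 = σ p.2)) = (Finset.univ.filter
        (fun p : (Fin n ⊕ Fin n) × (Fin n ⊕ Fin n) =>
        σ p.1 = σ p.2 ∧ u p.1 - u p.2 = W)) := by
      ext p
      simp only [Finset.mem_filter, Finset.mem_univ, true_and]
      rw [and_comm]
    rw [r1, r2] at this
    exact_mod_cast this
  have t6 := energy hn u0 u1
  have q1 : ∑ p ∈ (Finset.univ.filter
      (fun p : (Fin n ⊕ Fin n) × (Fin n ⊕ Fin n) => σ p.1 = σ p.2)), max (u p.1 - u p.2) 0 =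
      ∑ i, ∑ j, max (u0 i - u0 j) 0 + ∑ i, ∑ j, max (u1 i - u1 j) 0 := by
    rw [Finset.sum_filter, Fintype.sum_prod_type, Fintype.sum_sum_type]
    simp_rw [Fintype.sum_sum_type]
    simp [σ, u]
  have q2 : ∑ p ∈ (Finset.univ.filter
      (fun p : (Fin n ⊕ Fin n) × (Fin n ⊕ Fin n) => σ p.1 ≠ σ p.2)), max (u p.1 - u p.2 - 2) 0 =
      ∑ i, ∑ j, max (u0 i - u1 j - 2) 0 + ∑ i, ∑ j, max (u1 i - u0 j - 2) 0 := by
    rw [Finset.sum_filter, Fintype.sum_prod_type, Fintype.sum_sum_type]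
    simp_rw [Fintype.sum_sum_type]
    simp [σ, u]
  rw [q1, q2] at t5
  linarith
end

section
/- Let V be a finite-dimensional graded representation of the graded sl2 (h even, e and f odd) over a field of characteristic zero, decomposed into irreducible graded subrepresentations of dimensions r_i with highest-weight parities w_i. If W_i, W_j are two such summands with r_i or r_j even, then the quantity m_{ij} := Tr(h on (Hom(W_i,W_j)^e)_0) + Tr(h on (Hom(W_j,W_i)^e)_0) − r_i r_j is non-positive, and m_{ii} is strictly negative. -/
variable {K V : Type*} [Field K] [AddCommGroup V] [Module K V]

/-- An sl2-triple of linear endomorphisms: [h,e]=2e, [h,f]=-2f, [e,f]=h. -/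
def Sl2Rel (e h f : Module.End K V) : Prop :=
  h * e - e * h = 2 • e ∧ h * f - f * h = -(2 • f) ∧ e * f - f * e = h

/-- A submodule invariant under the sl2-action. -/
def Sl2Inv (e h f : Module.End K V) (W : Submodule K V) : Prop :=
  (∀ x ∈ W, e x ∈ W) ∧ (∀ x ∈ W, h x ∈ W) ∧ (∀ x ∈ W, f x ∈ W)

/-- A Z/2Z-grading V = V0 ⊕ V1 compatible with the graded sl2 (h even, e and f odd). -/
def Sl2Grading (e h f : Module.End K V) (V0 V1 : Submodule K V) : Prop :=
  IsCompl V0 V1 ∧ (∀ x ∈ V0, h x ∈ V0) ∧ (∀ x ∈ V1, h x ∈ V1) ∧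
    (∀ x ∈ V0, e x ∈ V1) ∧ (∀ x ∈ V1, e x ∈ V0) ∧
    (∀ x ∈ V0, f x ∈ V1) ∧ (∀ x ∈ V1, f x ∈ V0)

/-- A submodule which is graded with respect to the grading (V0, V1). -/
def Sl2GradedSub (V0 V1 W : Submodule K V) : Prop :=
  W = (W ⊓ V0) ⊔ (W ⊓ V1)

def parS {K V : Type*} [Field K] [AddCommGroup V] [Module K V] (V0 V1 : Submodule K V)
    (p : ZMod 2) : Submodule K V := if p = 0 then V0 else V1

lemma zmod2_cases (p : ZMod 2) : p = 0 ∨ p = 1 := by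
  revert p; decide

structure GoodD {K V : Type*} [Field K] [AddCommGroup V] [Module K V]
    (e h : Module.End K V) (V0 V1 : Submodule K V) (lam : ℕ) (w : ZMod 2)
    (y : ℕ → V) (cy : ℕ → (V →ₗ[K] K)) : Prop where
  coord : ∀ n m, m ≤ lam → cy n (y m) = if n = m then 1 else 0
  expand : ∀ x, x = ∑ n ∈ Finset.range (lam+1), cy n x • y n
  big : ∀ n, lam < n → cy n = 0
  par : ∀ p x n, x ∈ parS V0 V1 p → n ≤ lam → w + n ≠ p → cy n x = 0
  ymem : ∀ n, n ≤ lam → y n ∈ parS V0 V1 (w + n)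
  e0 : e (y 0) = 0
  es : ∀ n, n < lam → e (y (n+1)) = y n
  hy : ∀ n, n ≤ lam → h (y n) = ((lam : K) - 2 * n) • y n
  ce : ∀ n x, cy n (e x) = cy (n+1) x
  ch : ∀ n x, cy n (h x) = ((lam : K) - 2 * n) * cy n x

lemma trace_lem {K V W : Type*} [Field K]
    [AddCommGroup V] [Module K V] [AddCommGroup W] [Module K W]
    {eV hV : Module.End K V} {V0 V1 : Submodule K V} {lam1 : ℕ} {w1 : ZMod 2}
    {y : ℕ → V} {cy : ℕ → (V →ₗ[K] K)} (D : GoodD eV hV V0 V1 lam1 w1 y cy)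
    {eW hW : Module.End K W} {W0 W1 : Submodule K W} {lam2 : ℕ} {w2 : ZMod 2}
    {z : ℕ → W} {cz : ℕ → (W →ₗ[K] K)} (F : GoodD eW hW W0 W1 lam2 w2 z cz)
    (H : Module.End K (V →ₗ[K] W)) (hH : ∀ φ, H φ = hW ∘ₗ φ - φ ∘ₗ hV)
    (E : Submodule K (V →ₗ[K] W))
    (hE : ∀ φ : V →ₗ[K] W, φ ∈ E ↔
      (eW ∘ₗ φ - φ ∘ₗ eV = 0 ∧ (∀ x ∈ V0, φ x ∈ W0) ∧ (∀ x ∈ V1, φ x ∈ W1)))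
    (hinv : ∀ φ ∈ E, H φ ∈ E) :
    LinearMap.trace K _ (H.restrict hinv) =
      ((∑ j ∈ (Finset.range (min lam1 lam2 + 1)).filter
        (fun j : ℕ => w1 + w2 + lam1 + (j : ZMod 2) = 0), ((lam1 : ℤ) + lam2 - 2 * j) : ℤ) : K) := by
  classical
  set J := (Finset.range (min lam1 lam2 + 1)).filter
        (fun j : ℕ => w1 + w2 + lam1 + (j : ZMod 2) = 0) with hJ
  have hE' : ∀ φ : V →ₗ[K] W, φ ∈ E ↔
      ((∀ x, eW (φ x) = φ (eV x)) ∧ ∀ p, ∀ x ∈ parS V0 V1 p, φ x ∈ parS W0 W1 p) := by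
    intro φ
    rw [hE]
    constructor
    · rintro ⟨h1, h2, h3⟩
      refine ⟨fun x => ?_, fun p x hx => ?_⟩
      · have := LinearMap.congr_fun h1 x
        simpa [sub_eq_zero] using this
      · rcases zmod2_cases p with rfl | rfl
        · simpa [parS] using h2 x (by simpa [parS] using hx)
        · simpa [parS] using h3 x (by simpa [parS] using hx)
    · rintro ⟨h1, h2⟩
      refine ⟨?_, fun x hx => ?_, fun x hx => ?_⟩
      · ext x; simp [h1]
      · simpa [parS] using h2 0 x (by simpa [parS] using hx)
      · simpa [parS] using h2 1 x (by simpa [parS] using hx)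
  let φ : ℕ → (V →ₗ[K] W) := fun j =>
    ∑ t ∈ Finset.range (j+1), (cy (lam1 - j + t)).smulRight (z t)
  have φa : ∀ j x, φ j x = ∑ t ∈ Finset.range (j+1), cy (lam1 - j + t) x • z t := by
    intro j x; simp [φ, LinearMap.sum_apply]
  have Jm : ∀ j ∈ J, j ≤ lam1 ∧ j ≤ lam2 ∧ w1 + w2 + lam1 + (j : ZMod 2) = 0 := by
    intro j hj
    simp only [hJ, Finset.mem_filter, Finset.mem_range] at hj
    exact ⟨by omega, by omega, hj.2⟩
  have φtop : ∀ j ∈ J, φ j (y lam1) = z j := by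
    intro j hj
    obtain ⟨h1, h2, h3⟩ := Jm j hj
    rw [φa, Finset.sum_eq_single j]
    · rw [D.coord _ _ le_rfl, if_pos (by omega), one_smul]
    · intro t ht htj
      rw [D.coord _ _ le_rfl, if_neg (by omega), zero_smul]
    · intro h; simp at h
  have φE : ∀ j ∈ J, φ j ∈ E := by
    intro j hj
    obtain ⟨h1, h2, h3⟩ := Jm j hj
    rw [hE']
    refine ⟨fun x => ?_, fun p x hx => ?_⟩
    · rw [φa, φa, map_sum, Finset.sum_range_succ', Finset.sum_range_succ]
      simp only [map_smul, F.e0, smul_zero, add_zero, D.ce]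
      rw [D.big (lam1 - j + j + 1) (by omega)]
      simp only [LinearMap.zero_apply, zero_smul, add_zero]
      apply Finset.sum_congr rfl
      intro t ht
      rw [Finset.mem_range] at ht
      rw [F.es t (by omega), add_assoc]
    · rw [φa]
      apply Submodule.sum_mem
      intro t ht
      rw [Finset.mem_range] at ht
      by_cases hp : w1 + ((lam1 - j + t : ℕ) : ZMod 2) = p
      · apply Submodule.smul_mem
        have := F.ymem t (by omega)
        convert this using 2
        rw [← hp]
        push_cast [Nat.cast_sub h1]
        generalize (lam1 : ZMod 2) = a at *
        generalize (j : ZMod 2) = b at *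
        generalize (t : ZMod 2) = c at *
        revert h3
        clear * -
        revert w1 w2 a b c
        decide
      · rw [D.par p x _ hx (by omega) hp, zero_smul]
        exact Submodule.zero_mem _
  have φH : ∀ j ∈ J, H (φ j) = (((lam1 : ℤ) + lam2 - 2 * j : ℤ) : K) • φ j := by
    intro j hj
    obtain ⟨h1, h2, h3⟩ := Jm j hj
    ext x
    rw [hH]
    simp only [LinearMap.sub_apply, LinearMap.comp_apply, LinearMap.smul_apply]
    rw [φa, φa, map_sum, ← Finset.sum_sub_distrib, Finset.smul_sum]
    apply Finset.sum_congr rfl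
    intro t ht
    rw [Finset.mem_range] at ht
    rw [map_smul, F.hy t (by omega), D.ch, smul_smul, smul_smul, ← sub_smul]
    congr 1
    push_cast [Nat.cast_sub h1]
    ring
  have hli : LinearIndependent K (fun j : J => (⟨φ j, φE j j.2⟩ : E)) := by
    rw [Fintype.linearIndependent_iff]
    intro g hg i
    have h1 := congrArg (fun ψ : E => cz i.1 ((ψ : V →ₗ[K] W) (y lam1))) hg
    simp only [Submodule.coe_sum, Submodule.coe_smul, LinearMap.sum_apply, LinearMap.smul_apply,
      map_sum, map_smul, Submodule.coe_zero, LinearMap.zero_apply, map_zero] at h1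
    rw [Finset.sum_eq_single i] at h1
    · rw [φtop _ i.2, F.coord _ _ (Jm _ i.2).2.1] at h1
      simpa using h1
    · intro k _ hk
      rw [φtop _ k.2, F.coord _ _ (Jm _ k.2).2.1, if_neg]
      · simp
      · intro h; exact hk (Subtype.ext h.symm)
    · intro h; simp at h
  have key : ∀ ψ : V →ₗ[K] W, (∀ x, eW (ψ x) = ψ (eV x)) → ψ (y lam1) = 0 → ψ = 0 := by
    intro ψ h1 h2
    have h3 : ∀ k, k ≤ lam1 → ψ (y (lam1 - k)) = 0 := by
      intro k
      induction k with
      | zero => intro _; simpa using h2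
      | succ k ih =>
        intro hk
        have := D.es (lam1 - (k+1)) (by omega)
        rw [← this, ← h1, show lam1 - (k+1) + 1 = lam1 - k by omega, ih (by omega), map_zero]
    ext x
    rw [D.expand x, map_sum, LinearMap.zero_apply]
    apply Finset.sum_eq_zero
    intro n hn
    rw [Finset.mem_range] at hn
    have := h3 (lam1 - n) (by omega)
    rw [show lam1 - (lam1 - n) = n by omega] at this
    rw [map_smul, this, smul_zero]
  have hsp : ∀ ψ ∈ E, ψ = ∑ j ∈ J, cz j (ψ (y lam1)) • φ j := by
    intro ψ hψ
    obtain ⟨hc, hp⟩ := (hE' ψ).1 hψ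
    rw [← sub_eq_zero]
    apply key
    · intro x
      simp only [LinearMap.sub_apply, map_sub, hc, LinearMap.sum_apply, LinearMap.smul_apply,
        map_sum, map_smul]
      congr 1
      apply Finset.sum_congr rfl
      intro j hj
      rw [((hE' _).1 (φE j hj)).1]
    · have hep : ∀ k, k ≤ lam1 → ∀ n, cz (n + k) (ψ (y lam1)) = cz n (ψ (y (lam1 - k))) := by
        intro k
        induction k with
        | zero => intro _ n; simp
        | succ k ih =>
          intro hk n
          have := D.es (lam1 - (k+1)) (by omega)
          rw [← this, ← hc, F.ce, show lam1 - (k+1) + 1 = lam1 - k by omega, ← ih (by omega)]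
          congr 2; omega
      have hz : ∀ n, lam1 < n → cz n (ψ (y lam1)) = 0 := by
        intro n hn
        have h1 := hep lam1 le_rfl (n - lam1)
        rw [show n - lam1 + lam1 = n by omega] at h1
        rw [h1, Nat.sub_self, show n - lam1 = (n - lam1 - 1) + 1 by omega, ← F.ce, hc, D.e0]
        simp
      simp only [LinearMap.sub_apply, LinearMap.sum_apply, LinearMap.smul_apply]
      rw [sub_eq_zero]
      conv_lhs => rw [F.expand (ψ (y lam1))]
      rw [Finset.sum_congr rfl (fun j hj => by rw [φtop j hj] :
        ∀ j ∈ J, cz j (ψ (y lam1)) • (φ j) (y lam1) = cz j (ψ (y lam1)) • z j)]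
      symm
      apply Finset.sum_subset
      · intro j hj
        have := (Jm j hj).2.1
        simp; omega
      · intro n hn hnJ
        rw [Finset.mem_range] at hn
        by_cases hnl : lam1 < n
        · rw [hz n hnl, zero_smul]
        · have h4 : ¬ (w1 + w2 + lam1 + (n : ZMod 2) = 0) := by
            intro h
            apply hnJ
            simp only [hJ, Finset.mem_filter, Finset.mem_range]
            exact ⟨by omega, h⟩
          rw [F.par (w1 + lam1) _ n (hp _ _ (D.ymem lam1 le_rfl)) (by omega), zero_smul]
          intro h5
          apply h4
          generalize (lam1 : ZMod 2) = a at *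
          generalize (n : ZMod 2) = b at *
          revert h5
          clear * -
          revert w1 w2 a b
          decide
  have hspan : ⊤ ≤ Submodule.span K (Set.range (fun j : J => (⟨φ j, φE j j.2⟩ : E))) := by
    rintro ⟨ψ, hψ⟩ -
    have : (⟨ψ, hψ⟩ : E) = ∑ j : J, cz j (ψ (y lam1)) • (⟨φ j, φE j j.2⟩ : E) := by
      apply Subtype.ext
      simp only [Submodule.coe_sum, Submodule.coe_smul]
      conv_lhs => rw [hsp ψ hψ]
      exact (Finset.sum_coe_sort J (fun j => cz j (ψ (y lam1)) • φ j)).symm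
    rw [this]
    exact Submodule.sum_mem _ fun j _ => Submodule.smul_mem _ _ (Submodule.subset_span ⟨j, rfl⟩)
  let B := Module.Basis.mk hli hspan
  rw [LinearMap.trace_eq_matrix_trace K B, Matrix.trace]
  rw [Int.cast_sum, ← Finset.sum_coe_sort J]
  apply Finset.sum_congr rfl
  intro j _
  have hB : (H.restrict hinv) (B j) = (((lam1 : ℤ) + lam2 - 2 * (j.1 : ℤ) : ℤ) : K) • B j := by
    apply Subtype.ext
    rw [Module.Basis.mk_apply]
    exact φH j j.2
  rw [Matrix.diag_apply, LinearMap.toMatrix_apply, hB, map_smul]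
  simp

lemma exists_good {K V : Type*} [Field K] [CharZero K]
    [AddCommGroup V] [Module K V] [FiniteDimensional K V]
    (e h f : Module.End K V) (hrel : Sl2Rel e h f)
    (V0 V1 : Submodule K V) (hgr : Sl2Grading e h f V0 V1)
    (hirr : ∀ U : Submodule K V, Sl2Inv e h f U → U = ⊥ ∨ U = ⊤)
    (lam : ℕ) (w : ZMod 2)
    (v : V) (hv : v ≠ 0) (hve : e v = 0) (hvh : h v = (lam : K) • v)
    (hvpar : if w = 0 then v ∈ V0 else v ∈ V1) :
    ∃ y cy, GoodD e h V0 V1 lam w y cy := by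
  classical
  obtain ⟨r1, r2, r3⟩ := hrel
  obtain ⟨g0, g1, g2, g3, g4, g5, g6⟩ := hgr
  let x : ℕ → V := fun n => (f ^ n) v
  have x0 : x 0 = v := by simp [x]
  have xs : ∀ n, x (n+1) = f (x n) := by
    intro n; simp [x, pow_succ']
  have hf : ∀ u, h (f u) = f (h u) - (2:K) • f u := by
    intro u
    have := LinearMap.congr_fun r2 u
    simp only [LinearMap.sub_apply, Module.End.mul_apply, LinearMap.neg_apply,
      LinearMap.smul_apply] at this
    rw [sub_eq_iff_eq_add] at this
    rw [this, two_smul, two_smul]; abel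
  have ef : ∀ u, e (f u) = f (e u) + h u := by
    intro u
    have := LinearMap.congr_fun r3 u
    simp only [LinearMap.sub_apply, Module.End.mul_apply] at this
    rw [← this]; abel
  have hx : ∀ n : ℕ, h (x n) = ((lam : K) - 2 * n) • x n := by
    intro n
    induction n with
    | zero => simp [x0, hvh]
    | succ n ih =>
      rw [xs, hf, ih, map_smul, ← sub_smul]; congr 1; push_cast; ring
  have ex : ∀ n : ℕ, e (x (n+1)) = (((n : K) + 1) * (lam - n)) • x n := by
    intro n
    induction n with
    | zero => rw [xs, ef, x0, hve, hvh]; simp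
    | succ n ih =>
      rw [xs, ef, ih, map_smul, ← xs, hx, ← add_smul]; congr 1; push_cast; ring
  have winj : Function.Injective (fun n : ℕ => (lam : K) - 2 * n) := by
    intro a b hab
    simpa using hab
  have xne : ∀ n, n ≤ lam → x n ≠ 0 := by
    intro n
    induction n with
    | zero => intro _; rwa [x0]
    | succ n ih =>
      intro hn h0
      have h1 := ex n
      rw [h0, map_zero] at h1
      have h2 := (smul_eq_zero.1 h1.symm).resolve_right (ih (by omega))
      rcases mul_eq_zero.1 h2 with h3 | h3
      · exact Nat.cast_add_one_ne_zero n h3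
      · rw [sub_eq_zero] at h3
        have : lam = n := by exact_mod_cast h3
        omega
  have xtop : x (lam + 1) = 0 := by
    by_contra hne
    have hall : ∀ k, x (lam + 1 + k) ≠ 0 := by
      intro k
      induction k with
      | zero => exact hne
      | succ k ih =>
        intro h0
        have h1 := ex (lam + 1 + k)
        rw [show lam + 1 + k + 1 = lam + 1 + (k + 1) by omega, h0, map_zero] at h1
        have h2 := (smul_eq_zero.1 h1.symm).resolve_right ih
        rcases mul_eq_zero.1 h2 with h3 | h3
        · exact Nat.cast_add_one_ne_zero _ h3
        · rw [sub_eq_zero] at h3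
          have : lam = lam + 1 + k := by exact_mod_cast h3
          omega
    have li : LinearIndependent K x := by
      apply Module.End.eigenvectors_linearIndependent' h _ winj x
      intro n
      rw [Module.End.hasEigenvector_iff, Module.End.mem_eigenspace_iff]
      refine ⟨hx n, ?_⟩
      by_cases hn : n ≤ lam
      · exact xne n hn
      · have := hall (n - (lam + 1))
        rwa [show lam + 1 + (n - (lam+1)) = n by omega] at this
    have := li.finite
    exact not_finite ℕ
  -- normalisation
  let c : ℕ → K := fun n => ∏ i ∈ Finset.range n, (((i : K) + 1) * (lam - i))⁻¹
  have cs : ∀ n, c (n+1) = c n * (((n : K) + 1) * (lam - n))⁻¹ := fun n =>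
    Finset.prod_range_succ _ _
  have kne : ∀ n, n < lam → ((n : K) + 1) * (lam - n) ≠ 0 := by
    intro n hn
    apply mul_ne_zero (Nat.cast_add_one_ne_zero n)
    rw [sub_ne_zero]
    intro h3
    have : lam = n := by exact_mod_cast h3
    omega
  have cne : ∀ n, n ≤ lam → c n ≠ 0 := by
    intro n hn
    apply Finset.prod_ne_zero_iff.2
    intro i hi
    rw [Finset.mem_range] at hi
    exact inv_ne_zero (kne i (by omega))
  let y : ℕ → V := fun n => c n • x n
  have hy : ∀ n : ℕ, h (y n) = ((lam : K) - 2 * n) • y n := by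
    intro n
    simp only [y, map_smul, hx, smul_smul]; rw [mul_comm]
  have yne : ∀ n, n ≤ lam → y n ≠ 0 := fun n hn => smul_ne_zero (cne n hn) (xne n hn)
  have e0 : e (y 0) = 0 := by simp [y, x0, hve]
  have es : ∀ n, n < lam → e (y (n+1)) = y n := by
    intro n hn
    simp only [y, map_smul, ex, smul_smul, cs]
    congr 1
    rw [mul_assoc, inv_mul_cancel₀ (kne n hn), mul_one]
  have li : LinearIndependent K (fun n : Fin (lam+1) => y n) := by
    apply Module.End.eigenvectors_linearIndependent' h (fun n : Fin (lam+1) => (lam : K) - 2 * (n : ℕ))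
    · intro a b hab
      exact Fin.ext (winj hab)
    · intro n
      rw [Module.End.hasEigenvector_iff, Module.End.mem_eigenspace_iff]
      exact ⟨hy n, yne n (by omega)⟩
  have hspan : ⊤ ≤ Submodule.span K (Set.range (fun n : Fin (lam+1) => y n)) := by
    set U := Submodule.span K (Set.range (fun n : Fin (lam+1) => y n)) with hU
    have yU : ∀ n, n ≤ lam → y n ∈ U := fun n hn =>
      Submodule.subset_span ⟨⟨n, by omega⟩, rfl⟩
    have xU : ∀ n, n ≤ lam → x n ∈ U := by
      intro n hn
      have := U.smul_mem (c n)⁻¹ (yU n hn)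
      simpa [y, smul_smul, inv_mul_cancel₀ (cne n hn)] using this
    have gen : ∀ T : Module.End K V, (∀ n, n ≤ lam → T (y n) ∈ U) → ∀ u ∈ U, T u ∈ U := by
      intro T hT u hu
      have : U ≤ U.comap T := by
        conv_lhs => rw [hU]
        rw [Submodule.span_le]
        rintro _ ⟨n, rfl⟩
        exact hT n (by omega)
      exact this hu
    have inv : Sl2Inv e h f U := by
      refine ⟨gen e ?_, gen h ?_, gen f ?_⟩
      · intro n hn
        cases n with
        | zero => rw [e0]; exact U.zero_mem
        | succ n => rw [es n (by omega)]; exact yU n (by omega)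
      · intro n hn
        rw [hy]; exact U.smul_mem _ (yU n hn)
      · intro n hn
        simp only [y, map_smul, ← xs]
        apply U.smul_mem
        rcases Nat.lt_or_ge n lam with h1 | h1
        · exact xU _ h1
        · have : n = lam := le_antisymm hn h1
          rw [this, xtop]; exact U.zero_mem
    rcases hirr U inv with h1 | h1
    · exfalso
      have := yU 0 (by omega)
      rw [h1, Submodule.mem_bot] at this
      exact yne 0 (by omega) this
    · rw [h1]
  let b := Module.Basis.mk li hspan
  have hb : ∀ n : Fin (lam+1), b n = y n := fun n => by rw [Module.Basis.mk_apply]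
  let cy : ℕ → (V →ₗ[K] K) := fun n => if hn : n < lam + 1 then b.coord ⟨n, hn⟩ else 0
  have cyF : ∀ n : Fin (lam+1), cy n = b.coord n := by
    intro n; simp only [cy]; rw [dif_pos n.2]
  have big : ∀ n, lam < n → cy n = 0 := by
    intro n hn; simp only [cy]; rw [dif_neg (by omega)]
  have coord : ∀ n m, m ≤ lam → cy n (y m) = if n = m then 1 else 0 := by
    intro n m hm
    by_cases hn : n ≤ lam
    · have h1 := cyF ⟨n, by omega⟩
      have h2 := hb ⟨m, by omega⟩
      simp only at h1 h2
      rw [h1, ← h2, Module.Basis.coord_apply, Module.Basis.repr_self, Finsupp.single_apply]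
      simp [eq_comm]
    · rw [big n (by omega), if_neg (by omega)]; rfl
  have expand : ∀ x, x = ∑ n ∈ Finset.range (lam+1), cy n x • y n := by
    intro u
    rw [Finset.sum_range]
    conv_lhs => rw [← b.sum_repr u]
    apply Finset.sum_congr rfl
    intro n _
    rw [cyF, hb]; rfl
  have lext : ∀ p q : V →ₗ[K] K, (∀ m, m ≤ lam → p (y m) = q (y m)) → p = q := by
    intro p q hpq
    apply b.ext
    intro n
    rw [hb]; exact hpq n (by omega)
  have ymem : ∀ n : ℕ, y n ∈ parS V0 V1 (w + n) := by
    have : ∀ n : ℕ, x n ∈ parS V0 V1 (w + n) := by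
      intro n
      induction n with
      | zero =>
        rw [x0]; unfold parS; simp only [Nat.cast_zero, add_zero]
        split_ifs at hvpar ⊢ <;> assumption
      | succ n ih =>
        rw [xs]
        push_cast
        rw [← add_assoc]
        rcases zmod2_cases (w + n) with h1 | h1
        · rw [h1] at ih ⊢
          have := g5 _ (by simpa [parS] using ih)
          simpa [parS] using this
        · rw [h1] at ih ⊢
          have := g6 _ (by simpa [parS] using ih)
          rw [show (1 + 1 : ZMod 2) = 0 by decide]
          simpa [parS] using this
    exact fun n => Submodule.smul_mem _ _ (this n)
  refine ⟨y, cy, ⟨coord, expand, big, ?_, fun n _ => ymem n, e0, es, fun n _ => hy n, ?_, ?_⟩⟩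
  · intro p u n hu hn hp
    set A := ∑ n ∈ (Finset.range (lam+1)).filter (fun n : ℕ => w + n = p), cy n u • y n with hA
    set B := ∑ n ∈ (Finset.range (lam+1)).filter (fun n : ℕ => ¬ w + n = p), cy n u • y n with hB
    have hAB : A + B = u := by
      rw [hA, hB, Finset.sum_filter_add_sum_filter_not]; exact (expand u).symm
    have Am : A ∈ parS V0 V1 p := by
      apply Submodule.sum_mem
      intro m hm
      have h1 := (Finset.mem_filter.1 hm).2
      rw [← h1]; exact Submodule.smul_mem _ _ (ymem m)
    have Bm : B ∈ parS V0 V1 (p+1) := by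
      apply Submodule.sum_mem
      intro m hm
      have h1 := (Finset.mem_filter.1 hm).2
      have h2 : w + m = p + 1 := by
        generalize w + (m : ZMod 2) = q at h1
        revert h1; clear * -; revert p q; decide
      rw [← h2]; exact Submodule.smul_mem _ _ (ymem m)
    have Bm' : B ∈ parS V0 V1 p := by
      have : B = u - A := by rw [← hAB]; abel
      rw [this]; exact Submodule.sub_mem _ hu Am
    have B0 : B = 0 := by
      have hd := Submodule.disjoint_def.1 g0.disjoint
      rcases zmod2_cases p with rfl | rfl
      · exact hd B (by simpa [parS] using Bm') (by simpa [parS] using Bm)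
      · rw [show (1 + 1 : ZMod 2) = 0 by decide] at Bm
        exact hd B (by simpa [parS] using Bm) (by simpa [parS] using Bm')
    have h1 : cy n B = cy n u := by
      rw [hB, map_sum, Finset.sum_eq_single n]
      · rw [map_smul, coord n n hn]; simp
      · intro m hm hmn
        have := Finset.mem_range.1 (Finset.mem_filter.1 hm).1
        rw [map_smul, coord n m (by omega), if_neg (Ne.symm hmn), smul_zero]
      · intro h
        exact absurd (Finset.mem_filter.2 ⟨Finset.mem_range.2 (by omega), hp⟩) h
    rw [← h1, B0, map_zero]
  · intro n u
    have : (cy n) ∘ₗ e = cy (n+1) := by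
      apply lext
      intro m hm
      rw [LinearMap.comp_apply, coord _ _ hm]
      cases m with
      | zero => rw [e0]; simp
      | succ m => rw [es m (by omega), coord _ _ (by omega)]; simp
    exact LinearMap.congr_fun this u
  · intro n u
    have : (cy n) ∘ₗ h = ((lam : K) - 2 * n) • cy n := by
      apply lext
      intro m hm
      rw [LinearMap.comp_apply, hy, map_smul, LinearMap.smul_apply, coord _ _ hm]
      split_ifs with h1
      · rw [h1]
      · simp
    exact LinearMap.congr_fun this u

def SS (c : ℤ) (n : ℕ) (p : ZMod 2) : ℤ :=
  ∑ j ∈ (Finset.range n).filter (fun j : ℕ => p + (j : ZMod 2) = 0), (c - 2 * j)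

lemma SS_succ (c : ℤ) (n : ℕ) (p : ZMod 2) :
    SS c (n+1) p = SS c n p + if p + (n : ZMod 2) = 0 then c - 2 * n else 0 := by
  simp only [SS, Finset.sum_filter, Finset.sum_range_succ]

lemma SS_add (c : ℤ) (n : ℕ) (p : ZMod 2) :
    SS c n p + SS c n (p + 1) = n * c - n * (n - 1) := by
  induction n with
  | zero => simp [SS]
  | succ n ih =>
    rw [SS_succ, SS_succ]
    have h : (if p + (n : ZMod 2) = 0 then c - 2 * (n:ℤ) else 0)
        + (if p + 1 + (n : ZMod 2) = 0 then c - 2 * (n:ℤ) else 0) = c - 2 * n := by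
      generalize (n : ZMod 2) = a
      have : (p + a = 0 ∧ ¬ p + 1 + a = 0) ∨ (¬ p + a = 0 ∧ p + 1 + a = 0) := by
        clear ih; revert p a; clear * -; decide
      rcases this with ⟨h1, h2⟩ | ⟨h1, h2⟩
      · rw [if_pos h1, if_neg h2]; ring
      · rw [if_neg h1, if_pos h2]; ring
    push_cast
    linarith

lemma SS_even (c : ℤ) (k : ℕ) :
    SS c (2 * k) 0 = k * c - 2 * k * (k - 1) ∧ SS c (2 * k) 1 = k * c - 2 * k * k := by
  induction k with
  | zero => simp [SS]
  | succ k ih =>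
    have h2 : (2 : ZMod 2) = 0 := by decide
    have h3 : (1 + 1 : ZMod 2) = 0 := by decide
    rw [show 2 * (k+1) = 2 * k + 1 + 1 by ring]
    simp only [SS_succ, ih.1, ih.2]
    push_cast
    simp only [h2, h3, zero_mul, zero_add, add_zero, one_ne_zero, if_true, if_false]
    constructor <;> ring

/-- With W_i = V_{λ1}^{w1} and W_j = V_{λ2}^{w2} irreducible graded
sl2-representations of dimensions r1, r2, if r1 or r2 is even then the quantity
m_{ij} = Tr(h | (Hom(W_i,W_j)^e)_0) + Tr(h | (Hom(W_j,W_i)^e)_0) − r1·r2 is non-positive,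
and the diagonal quantity m_{ii} is strictly negative. -/
theorem stmt19 {K V W : Type*} [Field K] [CharZero K]
    [AddCommGroup V] [Module K V] [FiniteDimensional K V] [Nontrivial V]
    [AddCommGroup W] [Module K W] [FiniteDimensional K W] [Nontrivial W]
    (eV hV fV : Module.End K V) (hrelV : Sl2Rel eV hV fV)
    (V0 V1 : Submodule K V) (hgrV : Sl2Grading eV hV fV V0 V1)
    (hirrV : ∀ U : Submodule K V, Sl2Inv eV hV fV U → U = ⊥ ∨ U = ⊤)
    (lam1 : ℕ) (w1 : ZMod 2)
    (v : V) (hv : v ≠ 0) (hve : eV v = 0) (hvh : hV v = (lam1 : K) • v)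
    (hvpar : if w1 = 0 then v ∈ V0 else v ∈ V1)
    (eW hW fW : Module.End K W) (hrelW : Sl2Rel eW hW fW)
    (W0 W1 : Submodule K W) (hgrW : Sl2Grading eW hW fW W0 W1)
    (hirrW : ∀ U : Submodule K W, Sl2Inv eW hW fW U → U = ⊥ ∨ U = ⊤)
    (lam2 : ℕ) (w2 : ZMod 2)
    (w : W) (hw : w ≠ 0) (hwe : eW w = 0) (hwh : hW w = (lam2 : K) • w)
    (hwpar : if w2 = 0 then w ∈ W0 else w ∈ W1)
    -- the actions of h on the Hom spaces
    (H12 : Module.End K (V →ₗ[K] W)) (hH12 : ∀ φ, H12 φ = hW ∘ₗ φ - φ ∘ₗ hV)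
    (H21 : Module.End K (W →ₗ[K] V)) (hH21 : ∀ ψ, H21 ψ = hV ∘ₗ ψ - ψ ∘ₗ hW)
    (H11 : Module.End K (V →ₗ[K] V)) (hH11 : ∀ φ, H11 φ = hV ∘ₗ φ - φ ∘ₗ hV)
    -- the even parts of the kernels of the action of e on the Hom spaces
    (E12 : Submodule K (V →ₗ[K] W))
    (hE12 : ∀ φ : V →ₗ[K] W, φ ∈ E12 ↔
      (eW ∘ₗ φ - φ ∘ₗ eV = 0 ∧ (∀ x ∈ V0, φ x ∈ W0) ∧ (∀ x ∈ V1, φ x ∈ W1)))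
    (E21 : Submodule K (W →ₗ[K] V))
    (hE21 : ∀ ψ : W →ₗ[K] V, ψ ∈ E21 ↔
      (eV ∘ₗ ψ - ψ ∘ₗ eW = 0 ∧ (∀ x ∈ W0, ψ x ∈ V0) ∧ (∀ x ∈ W1, ψ x ∈ V1)))
    (E11 : Submodule K (V →ₗ[K] V))
    (hE11 : ∀ φ : V →ₗ[K] V, φ ∈ E11 ↔
      (eV ∘ₗ φ - φ ∘ₗ eV = 0 ∧ (∀ x ∈ V0, φ x ∈ V0) ∧ (∀ x ∈ V1, φ x ∈ V1)))
    (hinv12 : ∀ φ ∈ E12, H12 φ ∈ E12) (hinv21 : ∀ ψ ∈ E21, H21 ψ ∈ E21)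
    (hinv11 : ∀ φ ∈ E11, H11 φ ∈ E11)
    -- dimensions and the quantities m_{ij}, m_{ii}
    (r1 r2 : ℕ) (hr1 : r1 = lam1 + 1) (hr2 : r2 = lam2 + 1)
    (m12 m11 : K)
    (hm12 : m12 = LinearMap.trace K _ (H12.restrict hinv12) +
                  LinearMap.trace K _ (H21.restrict hinv21) - ((r1 * r2 : ℕ) : K))
    (hm11 : m11 = LinearMap.trace K _ (H11.restrict hinv11) +
                  LinearMap.trace K _ (H11.restrict hinv11) - ((r1 * r1 : ℕ) : K))
    (heven : r1 % 2 = 0 ∨ r2 % 2 = 0) :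
    (∃ a : ℤ, m12 = (a : K) ∧ a ≤ 0) ∧
    (r1 % 2 = 0 → ∃ a : ℤ, m11 = (a : K) ∧ a < 0) := by
  obtain ⟨y, cy, D⟩ := exists_good eV hV fV hrelV V0 V1 hgrV hirrV lam1 w1 v hv hve hvh hvpar
  obtain ⟨z, cz, F⟩ := exists_good eW hW fW hrelW W0 W1 hgrW hirrW lam2 w2 w hw hwe hwh hwpar
  have t12 := trace_lem D F H12 hH12 E12 hE12 hinv12
  have t21 := trace_lem F D H21 hH21 E21 hE21 hinv21
  have t11 := trace_lem D D H11 hH11 E11 hE11 hinv11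
  rw [t12, t21] at hm12
  rw [t11] at hm11
  change m12 = ((SS (lam1 + lam2) (min lam1 lam2 + 1) (w1 + w2 + lam1) : ℤ) : K) +
    ((SS (lam2 + lam1) (min lam2 lam1 + 1) (w2 + w1 + lam2) : ℤ) : K) - _ at hm12
  change m11 = ((SS (lam1 + lam1) (min lam1 lam1 + 1) (w1 + w1 + lam1) : ℤ) : K) +
    ((SS (lam1 + lam1) (min lam1 lam1 + 1) (w1 + w1 + lam1) : ℤ) : K) - _ at hm11
  subst hr1 hr2
  have cast_odd : ∀ n : ℕ, n % 2 = 1 → (n : ZMod 2) = 1 := fun n hn => by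
    rw [← ZMod.natCast_mod, hn]; simp
  have cast_even : ∀ n : ℕ, n % 2 = 0 → (n : ZMod 2) = 0 := fun n hn => by
    rw [← ZMod.natCast_mod, hn]; simp
  constructor
  · refine ⟨SS (lam1 + lam2) (min lam1 lam2 + 1) (w1 + w2 + lam1) +
      SS (lam2 + lam1) (min lam2 lam1 + 1) (w2 + w1 + lam2) - ((lam1 + 1) * (lam2 + 1) : ℕ), ?_, ?_⟩
    · rw [hm12]; push_cast; ring
    · clear hm12 hm11 t12 t21 t11
      rw [min_comm lam2 lam1, add_comm (lam2 : ℤ), add_comm w2 w1]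
      have hmM : (lam1 : ℤ) * lam2 = (min lam1 lam2 : ℕ) * (max lam1 lam2 : ℕ) := by
        exact_mod_cast (min_mul_max lam1 lam2).symm
      have hmP : (lam1 : ℤ) + lam2 = (min lam1 lam2 : ℕ) + (max lam1 lam2 : ℕ) := by
        exact_mod_cast (min_add_max lam1 lam2).symm
      have hprod : (((lam1 + 1) * (lam2 + 1) : ℕ) : ℤ) =
          ((min lam1 lam2 : ℕ) + 1) * ((max lam1 lam2 : ℕ) + 1) := by
        push_cast at *; linarith
      rw [hprod, hmP]
      by_cases hpar : (lam1 + lam2) % 2 = 1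
      · have h1 : w1 + w2 + (lam2 : ZMod 2) = w1 + w2 + lam1 + 1 := by
          have := cast_odd _ hpar
          push_cast at this
          generalize (lam1 : ZMod 2) = a at *
          generalize (lam2 : ZMod 2) = b at *
          revert this; clear * -; revert w1 w2 a b; decide
        rw [h1, SS_add]
        generalize min lam1 lam2 = m
        generalize max lam1 lam2 = M
        have : (0 : ℤ) ≤ m := by omega
        push_cast
        nlinarith
      · have e1 : lam1 % 2 = 1 := by omega
        have e2 : lam2 % 2 = 1 := by omega
        rw [cast_odd _ e1, cast_odd _ e2]
        obtain ⟨k, hk⟩ : ∃ k, min lam1 lam2 + 1 = 2 * k := ⟨(min lam1 lam2 + 1) / 2, by omega⟩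
        have hk' : ((min lam1 lam2 : ℕ) : ℤ) = 2 * k - 1 := by omega
        rw [hk, hk']
        rcases zmod2_cases (w1 + w2 + 1) with h | h
        · rw [h, (SS_even _ k).1]; nlinarith
        · rw [h, (SS_even _ k).2]; nlinarith
  · intro hr
    refine ⟨SS (lam1 + lam1) (min lam1 lam1 + 1) (w1 + w1 + lam1) +
      SS (lam1 + lam1) (min lam1 lam1 + 1) (w1 + w1 + lam1) - ((lam1 + 1) * (lam1 + 1) : ℕ), ?_, ?_⟩
    · rw [hm11]; push_cast; ring
    · clear hm12 hm11 t12 t21 t11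
      have h1 : w1 + w1 + (lam1 : ZMod 2) = 1 := by
        rw [cast_odd lam1 (by omega)]
        clear * -; revert w1; decide
      obtain ⟨k, hk⟩ : ∃ k, lam1 + 1 = 2 * k := ⟨(lam1 + 1) / 2, by omega⟩
      have hk' : (lam1 : ℤ) = 2 * k - 1 := by omega
      rw [h1, min_self, hk, (SS_even _ k).2, hk']
      have : (0 : ℤ) < k := by omega
      push_cast
      nlinarith
end
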